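/- arXiv:2410.16814 — 2 statements merged into one kernel-verified Lean document; each statement's English description precedes it below -/
import Mathlib

section
/- Let n ≥ 2, q an odd prime power, and P(t_1,...,t_n; x) = x^n + t_1 x^{n-1} + ... + t_n the generic polynomial of degree n. Let L = L_1 ⋯ L_n be a compositum inside a fixed algebraic closure, where each L_i is a finite extension of F̄_q(t_i). Then disc_x(P) ∈ F̄_q(t_1,...,t_n) is not a square in L. -/
open Polynomial

/-- The ambient algebraically closed field: an algebraic closure of the rational
function field `F̄(t_1, …, t_n) = Frac(F̄[t_1, …, t_n])`. -/
abbrev GenCl (Fbar : Type*) [Field Fbar] (n : ℕ) : Type _ :=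
  AlgebraicClosure (FractionRing (MvPolynomial (Fin n) Fbar))

/-- The indeterminate `t_i` viewed inside the ambient field. -/
noncomputable def genT (Fbar : Type*) [Field Fbar] (n : ℕ) (i : Fin n) :
    GenCl Fbar n :=
  algebraMap (FractionRing (MvPolynomial (Fin n) Fbar)) (GenCl Fbar n)
    (algebraMap (MvPolynomial (Fin n) Fbar)
      (FractionRing (MvPolynomial (Fin n) Fbar)) (MvPolynomial.X i))

/-- The copy of `F̄` (the constants) inside the ambient field. -/
noncomputable def constSubfield (Fbar : Type*) [Field Fbar] (n : ℕ) :
    Subfield (GenCl Fbar n) :=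
  ((algebraMap (FractionRing (MvPolynomial (Fin n) Fbar)) (GenCl Fbar n)).comp
    ((algebraMap (MvPolynomial (Fin n) Fbar)
      (FractionRing (MvPolynomial (Fin n) Fbar))).comp
        (MvPolynomial.C : Fbar →+* MvPolynomial (Fin n) Fbar))).fieldRange

/-- The subfield `F̄(t_i)` of the ambient field. -/
noncomputable def oneVarSubfield (Fbar : Type*) [Field Fbar] (n : ℕ) (i : Fin n) :
    Subfield (GenCl Fbar n) :=
  Subfield.closure ((constSubfield Fbar n : Set (GenCl Fbar n)) ∪ {genT Fbar n i})

/-- `L` is a finite extension of the subfield `E` (inside the ambient field):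
`E ≤ L` and `L` is generated over `E` by finitely many elements, each algebraic
over `E`. -/
def IsFiniteSubextension {C : Type*} [Field C] (E L : Subfield C) : Prop :=
  E ≤ L ∧ ∃ S : Finset C,
    (∀ x ∈ S, ∃ q : Polynomial E, q ≠ 0 ∧ Polynomial.eval₂ E.subtype x q = 0) ∧
    L = Subfield.closure ((E : Set C) ∪ (S : Set C))




lemma aux_card_le {F A : Type*} [Field F] [Field A] [Algebra F A] {m : ℕ} (t : Fin m → A)
    (ht : AlgebraicIndependent F t) (S : Finset A)
    (hS : ∀ i, IsAlgebraic (Algebra.adjoin F (S : Set A)) (t i)) : m ≤ S.card := by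
  have h1 : (AlgebraicIndependent.matroid F A).Indep (Set.range t) := by
    rw [AlgebraicIndependent.matroid_indep_iff]
    exact ht.coe_range
  have h2 : Set.range t ⊆ (AlgebraicIndependent.matroid F A).closure (S : Set A) := by
    rw [AlgebraicIndependent.matroid_closure_eq]
    rintro _ ⟨i, rfl⟩
    exact hS i
  have h3 := h1.encard_le_eRk_of_subset h2
  rw [Matroid.eRk_closure_eq] at h3
  have h4 := h3.trans (Matroid.eRk_le_encard _ _)
  rw [← Set.image_univ, (ht.injective).injOn.encard_image, Set.encard_coe_eq_coe_finsetCard] at h4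
  simpa using h4

lemma aux_galois {K k Ω : Type*} [Field K] [Field k] [Field Ω] [Algebra k Ω] [Algebra K Ω]
    [IsAlgClosed Ω] [Algebra.IsAlgebraic k Ω] (q : ℕ) [ExpChar k q]
    (hK : ∀ x : K, algebraMap K Ω x ∈ (algebraMap k Ω).range)
    (M : IntermediateField K Ω) [FiniteDimensional K M] (y : Ω)
    (hy : y ∈ IntermediateField.adjoin k (M : Set Ω)) (hy2 : y ^ 2 ∈ (algebraMap k Ω).range)
    (hy0 : y ≠ 0) :
    ∃ d : Ω, d ≠ 0 ∧ IsAlgebraic K d ∧ ∃ (m : ℕ) (c : k), y ^ (q ^ m) = d * algebraMap k Ω c := by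
  classical
  have hcl : IsAlgClosure k Ω := ⟨inferInstance, inferInstance⟩
  have hnorm : Normal k Ω := IsAlgClosure.normal k Ω
  let res : Gal(Ω/k) → (M →ₐ[K] Ω) := fun σ =>
    { (σ : Ω →+* Ω).comp (M.val : M →+* Ω) with
      commutes' := by
        intro r
        obtain ⟨s, hs⟩ := hK r
        change σ (algebraMap K Ω r) = _
        rw [← hs]; exact σ.commutes s }
  have hres : ∀ σ (x : M), res σ x = σ x := fun σ x => rfl
  -- the sign
  have hsign : ∀ σ : Gal(Ω/k), (σ y / y) ^ 2 = 1 := by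
    intro σ
    obtain ⟨s, hs⟩ := hy2
    rw [div_pow, ← map_pow, ← hs, σ.commutes, hs, div_self (pow_ne_zero 2 hy0)]
  have hagree : ∀ σ τ : Gal(Ω/k), res σ = res τ → σ y = τ y := by
    intro σ τ h
    have : IntermediateField.adjoin k (M : Set Ω) ≤
        (AlgHom.equalizer (σ : Ω →ₐ[k] Ω) (τ : Ω →ₐ[k] Ω)).toIntermediateField (by
          intro x hx
          simp only [AlgHom.mem_equalizer] at hx ⊢
          simpa using hx) := by
      rw [IntermediateField.adjoin_le_iff]
      intro x hx
      have := DFunLike.congr_fun h ⟨x, hx⟩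
      exact this
    exact this hy
  let Φ := Set.range res
  have : Finite Φ := inferInstance
  have : Fintype Φ := Fintype.ofFinite _
  choose lift hlift using fun φ : Φ => φ.2
  let χ : Φ → Ω := fun φ => lift φ y / y
  have hχ : ∀ (σ : Gal(Ω/k)), χ ⟨res σ, σ, rfl⟩ = σ y / y := by
    intro σ
    simp only [χ]
    rw [hagree _ σ (hlift _)]
  have hli : LinearIndependent Ω (fun (φ : Φ) => ((φ.1 : M →* Ω) : M → Ω)) := by
    refine (linearIndependent_monoidHom M Ω).comp (fun φ : Φ => (φ.1 : M →* Ω)) ?_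
    intro φ ψ h
    apply Subtype.ext
    ext x
    exact DFunLike.congr_fun h x
  have hex : ∃ x : M, ∑ φ : Φ, χ φ * φ.1 x ≠ 0 := by
    by_contra! hcon
    have := Fintype.linearIndependent_iff.1 hli χ (by
      ext x
      simpa using hcon x) ⟨res 1, 1, rfl⟩
    rw [hχ] at this
    simp [hy0] at this
  obtain ⟨x, hx⟩ := hex
  set d := ∑ φ : Φ, χ φ * φ.1 x with hd
  have hχval : ∀ φ, χ φ = 1 ∨ χ φ = -1 := fun φ => mul_self_eq_one_iff.1 (by rw [← sq]; exact hsign _)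
  have hσd : ∀ σ : Gal(Ω/k), σ d = (σ y / y) * d := by
    intro σ
    let e : Φ → Φ := fun φ => ⟨res (σ * lift φ), _, rfl⟩
    have he : Function.Bijective e := by
      rw [← Finite.injective_iff_bijective]
      intro φ ψ h
      rw [← Subtype.coe_inj, ← hlift φ, ← hlift ψ]
      have h' := congrArg Subtype.val h
      ext z
      have := DFunLike.congr_fun h' z
      simp only [e, hres, AlgEquiv.mul_apply] at this
      simpa [hres] using σ.injective this
    rw [hd, map_sum, Finset.mul_sum]
    refine Fintype.sum_bijective e he _ _ ?_
    intro φ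
    have h1 : χ (e φ) = σ (lift φ y) / y := hχ (σ * lift φ)
    have h2 : (e φ).1 x = σ (φ.1 x) := by
      conv_rhs => rw [← hlift φ]
      rfl
    rw [h1, h2, map_mul, ← mul_assoc]
    congr 1
    have h3 : lift φ y = χ φ * y := by simp only [χ]; field_simp
    rw [h3, map_mul]
    have h4 : σ (χ φ) = χ φ := by rcases hχval φ with h | h <;> simp [h]
    rw [h4]
    have := hsign σ
    field_simp at this ⊢
    linear_combination (-χ φ) * this
  have hdalg : IsAlgebraic K d := by
    rw [hd]
    refine Finset.sum_induction _ (IsAlgebraic K) (fun _ _ => IsAlgebraic.add) isAlgebraic_zero ?_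
    intro φ _
    apply IsAlgebraic.mul
    · rcases hχval φ with h | h <;> rw [h]
      · exact isAlgebraic_one
      · exact isAlgebraic_one.neg
    · exact (Algebra.IsAlgebraic.isAlgebraic (R := K) x).algHom φ.1
  · have hfix : ∀ σ : Gal(Ω/k), σ (y / d) = y / d := by
      intro σ
      rw [map_div₀, hσd]
      have : σ y ≠ 0 := by simpa using hy0
      field_simp
    have hp : y / d ∈ perfectClosure k Ω := by
      rw [mem_perfectClosure_iff_natSepDegree_eq_one, natSepDegree_eq_of_isAlgClosed (E := Ω),
        Finset.card_eq_one]
      have hint : IsAlgebraic k (y / d) := Algebra.IsAlgebraic.isAlgebraic _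
      refine ⟨y / d, ?_⟩
      ext w
      rw [Multiset.mem_toFinset, mem_aroots, Finset.mem_singleton]
      constructor
      · rintro ⟨_, h⟩
        obtain ⟨σ, hσ⟩ := minpoly.exists_algEquiv_of_root' hint h
        rw [← hσ, hfix]
      · rintro rfl
        exact ⟨minpoly.ne_zero hint.isIntegral, minpoly.aeval _ _⟩
    obtain ⟨m, c, hc⟩ := (mem_perfectClosure_iff_pow_mem q).1 hp
    exact ⟨d ^ q ^ m, pow_ne_zero _ hx, hdalg.pow _, m, c, by rw [hc, div_pow]; field_simp⟩


lemma aux_val {F A Ω : Type*} [Field F] [Field A] [Field Ω] [Algebra F A] [Algebra A Ω]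
    [Algebra F Ω] [IsScalarTower F A Ω] (b : Ω) (hb : Transcendental A b)
    (D : A[X]) (β : A) (hD : D.rootMultiplicity β = 1) (hβ : Transcendental F β)
    (e c : Ω) (he : e ∈ IntermediateField.adjoin A {b}) (hc : c ∈ IntermediateField.adjoin A {b})
    (halg : IsAlgebraic (IntermediateField.adjoin F {b}) e) (N : ℕ) (hN : Odd N)
    (h : (aeval b D) ^ N = e * c ^ 2) : False := by
  classical
  have hinj : ∀ P : A[X], aeval b P = 0 → P = 0 := fun P hP => by
    by_contra hne
    exact hb ⟨P, hne, hP⟩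
  have hD0 : D ≠ 0 := by
    rintro rfl
    simp at hD
  have hDb : aeval b D ≠ 0 := fun h0 => hD0 (hinj _ h0)
  have hec : e * c ^ 2 ≠ 0 := by rw [← h]; exact pow_ne_zero _ hDb
  have he0 : e ≠ 0 := left_ne_zero_of_mul hec
  have hc0 : c ≠ 0 := fun h0 => hec (by simp [h0])
  -- coprime representation of e
  have hrs : ∃ r s : A[X], IsCoprime r s ∧ r ≠ 0 ∧ s ≠ 0 ∧ e * aeval b s = aeval b r := by
    obtain ⟨r, s, rfl⟩ := (IntermediateField.mem_adjoin_simple_iff A e).1 he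
    have hr : aeval b r ≠ 0 := fun h0 => he0 (by simp [h0])
    have hs : aeval b s ≠ 0 := fun h0 => he0 (by simp [h0])
    have hs0 : s ≠ 0 := by rintro rfl; simp at hs
    have hr0 : r ≠ 0 := by rintro rfl; simp at hr
    obtain ⟨r', hr'⟩ := EuclideanDomain.gcd_dvd_left r s
    obtain ⟨s', hs'⟩ := EuclideanDomain.gcd_dvd_right r s
    have hg : EuclideanDomain.gcd r s ≠ 0 := fun h0 => hs0 (by rw [hs', h0, zero_mul])
    have hcop : IsCoprime r' s' := by
      refine ⟨EuclideanDomain.gcdA r s, EuclideanDomain.gcdB r s, ?_⟩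
      have hb := EuclideanDomain.gcd_eq_gcd_ab r s
      apply mul_left_cancel₀ hg
      linear_combination (-EuclideanDomain.gcdA r s) * hr' - EuclideanDomain.gcdB r s * hs' - hb
    refine ⟨r', s', hcop, ?_, ?_, ?_⟩
    · rintro rfl; simp at hr'; exact hr0 hr'
    · rintro rfl; simp at hs'; exact hs0 hs'
    · have e1 : aeval b r = aeval b (EuclideanDomain.gcd r s) * aeval b r' := by
        rw [← map_mul, ← hr']
      have e2 : aeval b s = aeval b (EuclideanDomain.gcd r s) * aeval b s' := by
        rw [← map_mul, ← hs']
      have hg' : aeval b (EuclideanDomain.gcd r s) ≠ 0 := fun h0 => hg (hinj _ h0)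
      rw [e2] at hs
      have := right_ne_zero_of_mul hs
      rw [e1, e2]
      field_simp
  obtain ⟨r, s, hcop, hr0, hs0, hers⟩ := hrs
  obtain ⟨g, hh, hcgh⟩ := (IntermediateField.mem_adjoin_simple_iff A c).1 hc
  have hgb : aeval b g ≠ 0 := fun h0 => hc0 (by simp [hcgh, h0])
  have hhb : aeval b hh ≠ 0 := fun h0 => hc0 (by simp [hcgh, h0])
  have hg0 : g ≠ 0 := by rintro rfl; simp at hgb
  have hh0 : hh ≠ 0 := by rintro rfl; simp at hhb
  -- polynomial relation
  have hrel : D ^ N * hh ^ 2 * s = r * g ^ 2 := by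
    rw [← sub_eq_zero]
    apply hinj
    simp only [map_sub, map_mul, map_pow]
    rw [h, hcgh, ← hers]
    field_simp
    ring
  -- algebraic relation
  have halg' : IsAlgebraic (Algebra.adjoin F {b}) e := IntermediateField.isAlgebraic_adjoin_iff.1 halg
  obtain ⟨G, hG0, hG⟩ := halg'.exists_nonzero_coeff_and_aeval_eq_zero
    (mem_nonZeroDivisors_of_ne_zero he0)
  have hco : ∀ i, ∃ a : F[X], aeval b a = ((G.coeff i : Algebra.adjoin F {b}) : Ω) := by
    intro i
    exact (Algebra.adjoin_mem_exists_aeval F b (G.coeff i).2).imp fun _ h => h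
  choose a ha using hco
  set d := G.natDegree with hd
  have hG' : G ≠ 0 := by rintro rfl; simp at hG0
  have haβ : ∀ i, G.coeff i ≠ 0 → aeval β (a i) ≠ 0 := by
    intro i hi h0
    apply hβ
    refine ⟨a i, ?_, h0⟩
    intro h1
    apply hi
    have := ha i
    rw [h1, map_zero] at this
    exact Subtype.ext this.symm
  have hH : ∑ i ∈ Finset.range (d + 1), (a i).map (algebraMap F A) * r ^ i * s ^ (d - i) = 0 := by
    apply hinj
    rw [map_sum]
    rw [aeval_eq_sum_range] at hG
    have : ∑ i ∈ Finset.range (d + 1), aeval b ((a i).map (algebraMap F A) * r ^ i * s ^ (d - i))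
        = (aeval b s) ^ d * ∑ i ∈ Finset.range (d + 1), G.coeff i • e ^ i := by
      rw [Finset.mul_sum]
      refine Finset.sum_congr rfl fun i hi => ?_
      have hi' : i ≤ d := by simpa [Nat.lt_succ_iff] using hi
      simp only [map_mul, map_pow, aeval_map_algebraMap]
      rw [ha, ← hers, Algebra.smul_def]
      change _ = _ * (((G.coeff i : Algebra.adjoin F {b}) : Ω) * _)
      rw [mul_pow]
      have h5 : (aeval b s) ^ d = (aeval b s) ^ i * (aeval b s) ^ (d - i) := by
        rw [← pow_add, Nat.add_sub_cancel' hi']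
      rw [h5]
      ring
    rw [this, hG, mul_zero]
  have hHβ : ∑ i ∈ Finset.range (d + 1), aeval β (a i) * (r.eval β) ^ i * (s.eval β) ^ (d - i) = 0 := by
    have := congrArg (eval β) hH
    simpa [eval_finsetSum, eval_map_algebraMap] using this
  obtain ⟨u, v, huv⟩ := hcop
  have huv' := congrArg (eval β) huv
  simp only [eval_add, eval_mul, eval_one] at huv'
  have hrβ : r.eval β ≠ 0 := by
    intro h0
    rw [Finset.sum_eq_single 0] at hHβ
    · have hsβ : s.eval β = 0 := by
        by_contra hne
        simp [haβ 0 hG0, hne] at hHβ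
      simp [h0, hsβ] at huv'
    · intro i _ hi; simp [h0, hi]
    · simp
  have hsβ : s.eval β ≠ 0 := by
    intro h0
    rw [Finset.sum_eq_single d] at hHβ
    · have := haβ d (by simpa [hd] using hG')
      simp [this, hrβ] at hHβ
    · intro i hi hne
      have hi' : d - i ≠ 0 := by simp at hi; omega
      simp [h0, hi']
    · simp
  have hpow : ∀ (P : A[X]) (j : ℕ), (P ^ j).rootMultiplicity β = j * P.rootMultiplicity β := by
    intro P j
    rw [← count_roots, ← count_roots, roots_pow, Multiset.count_nsmul]
  have hm := congrArg (rootMultiplicity β) hrel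
  rw [rootMultiplicity_mul (by positivity), rootMultiplicity_mul (by positivity),
    rootMultiplicity_mul (by positivity), hpow, hpow,
    hpow, hD, rootMultiplicity_eq_zero (p := r) hrβ,
    rootMultiplicity_eq_zero (p := s) hsβ] at hm
  obtain ⟨k, rfl⟩ := hN
  omega

lemma aux_coeff {B A : Type*} [CommRing B] [IsDomain B] [Field A] [Algebra B A]
    (R : Multiset A) (hR : ∀ r ∈ R, IsAlgebraic B r) (i : ℕ) :
    IsAlgebraic B ((R.map (fun r => X - C r)).prod.coeff i) := by
  induction R using Multiset.induction_on generalizing i with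
  | empty =>
    simp only [Multiset.map_zero, Multiset.prod_zero, coeff_one]
    split_ifs
    · exact isAlgebraic_one
    · exact isAlgebraic_zero
  | cons a R ih =>
    have h1 := ih (fun r hr => hR r (Multiset.mem_cons_of_mem hr))
    have ha := hR a (Multiset.mem_cons_self a R)
    rw [Multiset.map_cons, Multiset.prod_cons, sub_mul, coeff_sub, coeff_C_mul]
    refine IsAlgebraic.sub ?_ (ha.mul (h1 i))
    cases i with
    | zero => simpa using isAlgebraic_zero
    | succ i => rw [coeff_X_mul]; exact h1 i

lemma aux_geom {F A : Type*} [Field F] [Field A] [IsAlgClosed A] [Algebra F A] (h2 : (2 : A) ≠ 0)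
    {m : ℕ} (hm : 1 ≤ m) (t : Fin m → A) (ht : AlgebraicIndependent F t) (f : A[X])
    (hf : f = X ^ (m + 1) + ∑ i : Fin m, C (t i) * X ^ (m - (i : ℕ))) :
    derivative f ≠ 0 ∧ ∃ β : A, Transcendental F β ∧
      ((derivative f).roots.map (fun c => X - C (-(f.eval c)))).prod.rootMultiplicity β = 1 := by
  classical
  have hcoeff : ∀ i : Fin m, f.coeff (m - (i : ℕ)) = t i := by
    intro i
    rw [hf, coeff_add, coeff_X_pow, if_neg (by omega), zero_add, finsetSum_coeff,
      Finset.sum_eq_single i]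
    · simp
    · intro j _ hj
      rw [coeff_C_mul, coeff_X_pow, if_neg, mul_zero]
      intro h
      apply hj
      ext
      have := i.2
      have := j.2
      omega
    · simp
  have hdeg' : (∑ i : Fin m, C (t i) * X ^ (m - (i : ℕ))).degree < ((m + 1 : ℕ) : WithBot ℕ) := by
    refine (degree_sum_le _ _).trans_lt ?_
    rw [Finset.sup_lt_iff (WithBot.bot_lt_coe _)]
    intro i _
    refine (degree_C_mul_X_pow_le _ _).trans_lt ?_
    exact_mod_cast (by omega : m - (i : ℕ) < m + 1)
  have hmonic : f.Monic := by rw [hf]; exact monic_X_pow_add hdeg'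
  have hnat : f.natDegree = m + 1 := by
    rw [hf]
    refine natDegree_eq_of_degree_eq_some ?_
    rw [degree_add_eq_left_of_degree_lt (by rwa [degree_X_pow]), degree_X_pow]
  have hf0 : f.eval 0 = 0 := by
    rw [hf, eval_add, eval_finsetSum]
    simp only [eval_pow, eval_X, eval_mul, eval_C]
    rw [zero_pow (by omega), zero_add]
    refine Finset.sum_eq_zero fun i _ => ?_
    rw [zero_pow (by omega), mul_zero]
  have ht0 : ∀ i, t i ≠ 0 := fun i => ht.ne_zero i
  -- the derivative is nonconstant
  have hder : 1 ≤ (derivative f).natDegree := by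
    by_cases hch : ((m : A) + 1) = 0
    · have hm1 : m ≠ 1 := by
        rintro rfl
        apply h2
        rw [← hch]; norm_num
      refine le_trans (by omega : 1 ≤ m - 1) (le_natDegree_of_ne_zero ?_)
      rw [coeff_derivative, Nat.sub_add_cancel hm]
      have := hcoeff ⟨0, hm⟩
      simp only [tsub_zero] at this
      rw [this]
      refine mul_ne_zero (ht0 _) ?_
      have : ((m - 1 : ℕ) : A) + 1 = m := by
        exact_mod_cast congrArg (Nat.cast (R := A)) (Nat.sub_add_cancel hm)
      rw [this]
      intro h0
      rw [h0] at hch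
      simp at hch
    · refine le_trans hm (le_natDegree_of_ne_zero ?_)
      rw [coeff_derivative, ← hnat, hmonic.coeff_natDegree, one_mul]
      exact hch
  have hder0 : derivative f ≠ 0 := by
    intro h0
    rw [h0] at hder
    simp at hder
  refine ⟨hder0, ?_⟩
  obtain ⟨c, hc⟩ := IsAlgClosed.exists_root (derivative f) (by
    intro h0
    rw [natDegree_eq_zero_iff_degree_le_zero.2 h0.le] at hder
    omega)
  set g := f - C (f.eval c) with hg
  have hgdeg : (C (f.eval c)).degree < f.degree := by
    refine degree_C_le.trans_lt ?_
    rw [← natDegree_pos_iff_degree_pos]; omega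
  have hgmonic : g.Monic := hmonic.sub_of_left hgdeg
  have hgnat : g.natDegree = m + 1 := by
    rw [hg, natDegree_sub_C, hnat]
  have hg' : derivative g = derivative f := by simp [hg]
  have hgprod : g = (g.roots.map (fun r => X - C r)).prod :=
    ((IsAlgClosed.splits g).eq_prod_roots_of_monic hgmonic)
  have hgcard : g.roots.card = m + 1 := by
    rw [← hgnat]; exact ((IsAlgClosed.splits g).natDegree_eq_card_roots).symm
  have hgne : g ≠ 0 := hgmonic.ne_zero
  have hmult : ∀ x, g.eval x = 0 → (derivative f).eval x = 0 → 2 ≤ g.roots.count x := by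
    intro x h1 h3
    rw [count_roots]
    exact (one_lt_rootMultiplicity_iff_isRoot hgne).2 ⟨h1, by rw [hg']; exact h3⟩
  have hcg : g.eval c = 0 := by simp [hg]
  have hc2 := hmult c hcg hc
  obtain ⟨R', hR'⟩ : ∃ R', g.roots = c ::ₘ c ::ₘ R' := by
    obtain ⟨R', h⟩ := Multiset.le_iff_exists_add.1 (Multiset.le_count_iff_replicate_le.1 hc2)
    refine ⟨R', ?_⟩
    rw [h]; simp [Multiset.replicate_succ]
  have hR'card : R'.card + 1 = m := by
    rw [hR'] at hgcard
    simp at hgcard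
    omega
  have hkey : ∀ S : Finset A, (∀ r ∈ g.roots, IsAlgebraic (Algebra.adjoin F (S : Set A)) r) →
      m ≤ S.card := by
    intro S hS
    refine aux_card_le t ht S fun i => ?_
    have := aux_coeff g.roots hS (m - (i : ℕ))
    rw [← hgprod, hg, coeff_sub, hcoeff, coeff_C, if_neg (by omega), sub_zero] at this
    exact this
  have hmemalg : ∀ (S : Finset A) (x : A), x ∈ S → IsAlgebraic (Algebra.adjoin F (S : Set A)) x :=
    fun S x hx => isAlgebraic_algebraMap
      (⟨x, Algebra.subset_adjoin hx⟩ : Algebra.adjoin F (S : Set A))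
  have hnodup : (c ::ₘ R').Nodup := by
    rw [← Multiset.toFinset_card_eq_card_iff_nodup]
    apply le_antisymm (Multiset.toFinset_card_le _)
    rw [Multiset.card_cons, hR'card]
    apply hkey
    intro r hr
    apply hmemalg
    rw [hR'] at hr
    simpa using hr
  have h0 : (0 : A) ∉ (c ::ₘ R') := by
    intro h0
    have h0' : (0 : A) ∈ (c ::ₘ R').toFinset := by simpa using h0
    have hle := hkey ((c ::ₘ R').toFinset.erase 0) (by
      intro r hr
      by_cases hr0 : r = 0
      · rw [hr0]; exact isAlgebraic_zero
      · apply hmemalg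
        rw [hR'] at hr
        rw [Finset.mem_erase]
        exact ⟨hr0, by simpa using hr⟩)
    rw [Finset.card_erase_of_mem h0', Multiset.toFinset_card_of_nodup hnodup, Multiset.card_cons]
      at hle
    omega
  rw [Multiset.mem_cons, not_or] at h0
  rw [Multiset.nodup_cons] at hnodup
  have hβval : -(f.eval c) = (-c) * ((-c) * (R'.map (fun r => -r)).prod) := by
    have h1 : g.eval 0 = -(f.eval c) := by simp [hg, hf0]
    rw [← h1, hgprod, hR']
    simp [eval_multiset_prod]
  refine ⟨-(f.eval c), ?_, ?_⟩
  · intro halg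
    have hle := hkey R'.toFinset (by
      have hmem : ∀ r ∈ R', IsAlgebraic (Algebra.adjoin F (R'.toFinset : Set A)) r := by
        intro r hr
        exact hmemalg _ _ (by simpa using hr)
      have hcalg : IsAlgebraic (Algebra.adjoin F (R'.toFinset : Set A)) c := by
        set w := (R'.map (fun r => -r)).prod with hw
        have hw0 : w ≠ 0 := by
          rw [hw]
          apply Multiset.prod_ne_zero
          rw [Multiset.mem_map]
          rintro ⟨r, hr, hr0⟩
          rw [neg_eq_zero] at hr0
          exact h0.2 (hr0 ▸ hr)
        have hwalg : IsAlgebraic (Algebra.adjoin F (R'.toFinset : Set A)) w := by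
          have := aux_coeff R' hmem 0
          rw [coeff_zero_eq_eval_zero, eval_multiset_prod] at this
          simpa [hw] using this
        have hsq : c ^ 2 = -(f.eval c) * w⁻¹ := by
          rw [hβval]; field_simp
        apply IsAlgebraic.of_pow (n := 2) (by norm_num)
        rw [hsq]
        exact (halg.extendScalars (FaithfulSMul.algebraMap_injective F _)).mul hwalg.inv
      intro r hr
      rw [hR'] at hr
      simp only [Multiset.mem_cons] at hr
      rcases hr with rfl | rfl | hr
      · exact hcalg
      · exact hcalg
      · exact hmem r hr)
    have := Multiset.toFinset_card_le R'
    omega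
  · have hcr : c ∈ (derivative f).roots := (mem_roots hder0).2 hc
    obtain ⟨T, hT⟩ := Multiset.exists_cons_of_mem hcr
    have hmap : ((derivative f).roots.map (fun c => X - C (-(f.eval c)))) =
        (((derivative f).roots.map (fun c => -(f.eval c))).map (fun r => X - C r)) := by
      rw [Multiset.map_map]; rfl
    rw [hmap, ← count_roots, roots_multiset_prod_X_sub_C, hT, Multiset.map_cons,
      Multiset.count_cons_self, Nat.add_eq_right, Multiset.count_eq_zero, Multiset.mem_map]
    rintro ⟨c', hc'T, hc'⟩
    have hc'r : c' ∈ (derivative f).roots := by rw [hT]; exact Multiset.mem_cons_of_mem hc'T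
    have hcnt := hmult c' (by simp [hg, neg_injective hc']) ((mem_roots hder0).1 hc'r)
    by_cases hcc : c' = c
    · subst hcc
      have hcnt2 : 1 < (derivative f).rootMultiplicity c' := by
        rw [← count_roots, hT, Multiset.count_cons_self]
        have := Multiset.count_pos.2 hc'T
        omega
      have hd2 := ((one_lt_rootMultiplicity_iff_isRoot hder0).1 hcnt2).2
      rw [← hg', hgprod, hR'] at hd2
      simp only [Multiset.map_cons, Multiset.prod_cons] at hd2
      simp [derivative_mul] at hd2
      rw [← two_mul, mul_eq_zero, or_iff_right h2, eval_multiset_prod, Multiset.map_map,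
        Multiset.prod_eq_zero_iff, Multiset.mem_map] at hd2
      obtain ⟨r, hr, hr0⟩ := hd2
      simp only [Function.comp, eval_sub, eval_X, eval_C, sub_eq_zero] at hr0
      exact hnodup.1 (hr0 ▸ hr)
    · rw [hR', Multiset.count_cons_of_ne hcc, Multiset.count_cons_of_ne hcc] at hcnt
      have := Multiset.nodup_iff_count_le_one.1 hnodup.2 c'
      omega



lemma aux_disc1 {Ω : Type*} [Field Ω] {n : ℕ} (z : Fin n → Ω) :
    ∃ N : ℕ, (∏ pr ∈ Finset.univ.filter (fun pr : Fin n × Fin n => pr.1 < pr.2),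
      (z pr.1 - z pr.2) ^ 2) =
      (-1) ^ N * ∏ i, (derivative (∏ i : Fin n, (X - C (z i)))).eval (z i) := by
  classical
  have h1 : ∀ i, (derivative (∏ i : Fin n, (X - C (z i)))).eval (z i) =
      (∏ j, if i < j then z i - z j else 1) * ∏ j, if j < i then z i - z j else 1 := by
    intro i
    have := Lagrange.eval_nodal_derivative_eval_node_eq (s := Finset.univ) (v := z)
      (Finset.mem_univ i)
    rw [Lagrange.nodal] at this
    rw [this, ← Finset.prod_mul_distrib]
    have hsplit := Finset.mul_prod_erase Finset.univ
      (fun j => (if i < j then z i - z j else 1) * if j < i then z i - z j else 1)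
      (Finset.mem_univ i)
    rw [← hsplit]
    have hone : ((if i < i then z i - z i else 1) * if i < i then z i - z i else 1) = 1 := by simp
    rw [hone, one_mul, Lagrange.eval_nodal]
    apply Finset.prod_congr rfl
    intro j hj
    rcases lt_trichotomy i j with h | h | h
    · simp [h, h.not_gt]
    · simp [h] at hj
    · simp [h, h.not_gt]
  refine ⟨(Finset.univ.filter (fun pr : Fin n × Fin n => pr.1 < pr.2)).card, ?_⟩
  simp_rw [h1]
  rw [Finset.prod_mul_distrib]
  have h2 : (∏ i, ∏ j, if j < i then z i - z j else 1) =
      ∏ i, ∏ j, if i < j then z j - z i else 1 := Finset.prod_comm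
  rw [h2, ← Finset.prod_mul_distrib]
  simp_rw [← Finset.prod_mul_distrib]
  rw [← Fintype.prod_prod_type' (f := fun i j => (if i < j then z i - z j else 1) *
    (if i < j then z j - z i else 1)), ← Finset.prod_const, Finset.prod_filter, Finset.prod_filter,
    ← Finset.prod_mul_distrib]
  refine Finset.prod_congr rfl fun pr _ => ?_
  split_ifs
  · ring
  · ring

lemma aux_disc {A Ω : Type*} [Field A] [IsAlgClosed A] [Field Ω] [Algebra A Ω] {n : ℕ}
    (z : Fin n → Ω) (b : Ω) (f : A[X]) (hder : derivative f ≠ 0)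
    (hz : f.map (algebraMap A Ω) + C b = ∏ i : Fin n, (X - C (z i))) :
    ∃ u : A, u ≠ 0 ∧ (∏ pr ∈ Finset.univ.filter (fun pr : Fin n × Fin n => pr.1 < pr.2),
      (z pr.1 - z pr.2) ^ 2) =
      aeval b (C u * ((derivative f).roots.map (fun c => X - C (-(f.eval c)))).prod) := by
  obtain ⟨N, hN⟩ := aux_disc1 z
  have hfac : derivative f = C (derivative f).leadingCoeff *
      ((derivative f).roots.map (fun c => X - C c)).prod :=
    (IsAlgClosed.splits _).eq_prod_roots
  have hd : derivative (∏ i : Fin n, (X - C (z i))) = (derivative f).map (algebraMap A Ω) := by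
    rw [← hz]; simp [derivative_map]
  set R := (derivative f).roots with hR
  set l := (derivative f).leadingCoeff with hl
  have hl0 : l ≠ 0 := by rw [hl]; exact leadingCoeff_ne_zero.2 hder
  refine ⟨(-1) ^ N * l ^ n * ((-1) ^ n) ^ R.card, ?_, ?_⟩
  · refine mul_ne_zero (mul_ne_zero ?_ (pow_ne_zero _ hl0)) ?_ <;> simp
  rw [hN, hd]
  have h1 : ∀ i, ((derivative f).map (algebraMap A Ω)).eval (z i) =
      algebraMap A Ω l * (R.map (fun c => z i - algebraMap A Ω c)).prod := by
    intro i
    rw [hfac, eval_map_algebraMap, map_mul, aeval_C, map_multiset_prod, Multiset.map_map]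
    simp
  simp_rw [h1]
  rw [Finset.prod_mul_distrib, Finset.prod_const, Finset.card_univ, Fintype.card_fin]
  have h2 : ∏ i, (R.map (fun c => z i - algebraMap A Ω c)).prod =
      (R.map (fun c => ∏ i, (z i - algebraMap A Ω c))).prod := by
    rw [Multiset.prod_map_prod]
  have h3 : ∀ c, ∏ i, (z i - algebraMap A Ω c) = (-1) ^ n * (b + algebraMap A Ω (f.eval c)) := by
    intro c
    have := congrArg (eval (algebraMap A Ω c)) hz
    rw [eval_add, eval_C, eval_map_algebraMap, aeval_algebraMap_apply, eval_prod] at this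
    simp only [eval_sub, eval_X, eval_C] at this
    rw [add_comm, ← coe_aeval_eq_eval, this]
    have hpn : (-1 : Ω) ^ n = ∏ _i : Fin n, (-1 : Ω) := by simp
    rw [hpn, ← Finset.prod_mul_distrib]
    exact Finset.prod_congr rfl fun i _ => by ring
  rw [h2]
  simp_rw [h3]
  rw [Multiset.prod_map_mul, Multiset.map_const', Multiset.prod_replicate, map_mul, aeval_C,
    map_multiset_prod, Multiset.map_map]
  simp
  ring


lemma aux_core {F A Ω : Type*} [Field F] [Field A] [Field Ω] [Algebra F A] [Algebra A Ω]
    [Algebra F Ω] [IsScalarTower F A Ω] [IsAlgClosed Ω] (q : ℕ) [ExpChar A q] (hq : Odd q)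
    (b : Ω) (hb : Transcendental A b)
    (hΩ : Algebra.IsAlgebraic (IntermediateField.adjoin A {b}) Ω)
    (D : A[X]) (β : A) (hD : D.rootMultiplicity β = 1) (hβ : Transcendental F β)
    (y : Ω) (hy : y ∈ Subfield.closure (Set.range (algebraMap A Ω) ∪
      {x : Ω | IsAlgebraic (IntermediateField.adjoin F {b}) x}))
    (h : y ^ 2 = aeval b D) : False := by
  set k := IntermediateField.adjoin A {b} with hk
  set K := IntermediateField.adjoin F {b} with hKdef
  have hbk : b ∈ k := IntermediateField.mem_adjoin_simple_self A b
  have hD0 : D ≠ 0 := by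
    rintro rfl
    simp at hD
  have hDb : aeval b D ≠ 0 := fun h0 => hb ⟨D, hD0, h0⟩
  have hDk : aeval b D ∈ k := by
    have : aeval b D = algebraMap k Ω (aeval (⟨b, hbk⟩ : k) D) := by
      rw [← aeval_algebraMap_apply]; rfl
    rw [this]; exact (aeval (⟨b, hbk⟩ : k) D).2
  have hK : ∀ x : K, algebraMap K Ω x ∈ (algebraMap k Ω).range := by
    have : K ≤ IntermediateField.restrictScalars F k := by
      rw [hKdef, IntermediateField.adjoin_le_iff]
      intro x hx
      rw [Set.mem_singleton_iff] at hx
      rw [hx]; exact hbk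
    intro x
    exact ⟨⟨x, this x.2⟩, rfl⟩
  have hy1 : y ∈ IntermediateField.adjoin k {x : Ω | IsAlgebraic K x} := by
    have : Subfield.closure (Set.range (algebraMap A Ω) ∪ {x : Ω | IsAlgebraic K x}) ≤
        (IntermediateField.adjoin k {x : Ω | IsAlgebraic K x}).toSubfield := by
      rw [Subfield.closure_le]
      rintro x (⟨a, rfl⟩ | hx)
      · exact (IntermediateField.adjoin k {x : Ω | IsAlgebraic K x}).algebraMap_mem
          (algebraMap A k a)
      · exact IntermediateField.subset_adjoin _ _ hx
    exact this hy
  obtain ⟨T, hT, hyT⟩ := IntermediateField.exists_finset_of_mem_adjoin hy1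
  let M := IntermediateField.adjoin K (T : Set Ω)
  have hfin : FiniteDimensional K M :=
    IntermediateField.finiteDimensional_adjoin fun x hx => (hT hx).isIntegral
  have hyM : y ∈ IntermediateField.adjoin k (M : Set Ω) :=
    IntermediateField.adjoin.mono _ _ _ (IntermediateField.subset_adjoin K (T : Set Ω)) hyT
  have hec : ExpChar k q := expChar_of_injective_algebraMap (algebraMap A k).injective q
  obtain ⟨d, hd0, hdalg, m, c, hdc⟩ := aux_galois (K := K) (k := k) q hK M y hyM
    (by rw [h]; exact ⟨⟨_, hDk⟩, rfl⟩)
    (by rintro rfl; apply hDb; rw [← h]; simp)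
  have hy0 : y ≠ 0 := by rintro rfl; apply hDb; rw [← h]; simp
  have hc0 : (c : Ω) ≠ 0 := by
    intro h0
    have : algebraMap k Ω c = 0 := h0
    rw [this, mul_zero] at hdc
    exact pow_ne_zero _ hy0 hdc
  have hfinal : (aeval b D) ^ (q ^ m) = d ^ 2 * (c : Ω) ^ 2 := by
    rw [← h, ← pow_mul, mul_comm, pow_mul, hdc, mul_pow]; rfl
  have hek : d ^ 2 ∈ k := by
    have : d ^ 2 = (aeval b D) ^ (q ^ m) / (c : Ω) ^ 2 := by
      rw [hfinal]; field_simp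
    rw [this]
    exact div_mem (pow_mem hDk _) (pow_mem c.2 _)
  exact aux_val b hb D β hD hβ (d ^ 2) c hek c.2 (hdalg.pow 2) (q ^ m) hq.pow hfinal

lemma aux_L {F Ω : Type*} [Field F] [Field Ω] [Algebra F Ω] (K : IntermediateField F Ω)
    (E L : Subfield Ω) (hE : E ≤ K.toSubfield) (hL : IsFiniteSubextension E L) :
    ∀ x ∈ L, IsAlgebraic K x := by
  obtain ⟨_, S, hS, rfl⟩ := hL
  have : Subfield.closure ((E : Set Ω) ∪ (S : Set Ω)) ≤ (algebraicClosure K Ω).toSubfield := by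
    rw [Subfield.closure_le]
    rintro x (hx | hx)
    · exact (algebraicClosure K Ω).algebraMap_mem ⟨x, hE hx⟩
    · obtain ⟨q, hq0, hq⟩ := hS x hx
      have : IsAlgebraic K x := by
        let φ : E →+* K := Subfield.inclusion hE
        refine ⟨q.map φ, (Polynomial.map_ne_zero_iff φ.injective).2 hq0, ?_⟩
        rw [aeval_def, eval₂_map]
        exact hq
      exact mem_algebraicClosure_iff.2 this
  intro x hx
  exact mem_algebraicClosure_iff.1 (this hx)

lemma aux_oneVar (Fbar : Type*) [Field Fbar] (n : ℕ) (i : Fin n)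
    (K : IntermediateField Fbar (GenCl Fbar n)) (hi : genT Fbar n i ∈ K) :
    oneVarSubfield Fbar n i ≤ K.toSubfield := by
  rw [oneVarSubfield, Subfield.closure_le]
  rintro x (hx | hx)
  · obtain ⟨a, rfl⟩ := hx
    exact K.algebraMap_mem a
  · rw [Set.mem_singleton_iff] at hx
    rw [hx]; exact hi

lemma aux_ind (Fbar : Type*) [Field Fbar] (n : ℕ) :
    AlgebraicIndependent Fbar (genT Fbar n) := by
  have h := MvPolynomial.algebraicIndependent_X (Fin n) Fbar
  have := h.map' (f := IsScalarTower.toAlgHom Fbar (MvPolynomial (Fin n) Fbar) (GenCl Fbar n))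
    (by
      intro x y hxy
      exact IsFractionRing.injective (MvPolynomial (Fin n) Fbar)
        (FractionRing (MvPolynomial (Fin n) Fbar))
        ((algebraMap (FractionRing (MvPolynomial (Fin n) Fbar)) (GenCl Fbar n)).injective hxy))
  exact this

lemma aux_alg (Fbar : Type*) [Field Fbar] (n : ℕ) {A : Type*} [Field A] [Algebra A (GenCl Fbar n)]
    (k : IntermediateField A (GenCl Fbar n)) (hc : ∀ a, algebraMap Fbar (GenCl Fbar n) a ∈ k)
    (ht : ∀ i, genT Fbar n i ∈ k) : Algebra.IsAlgebraic k (GenCl Fbar n) := by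
  have h1 : ∀ P : MvPolynomial (Fin n) Fbar, algebraMap _ (GenCl Fbar n) P ∈ k := by
    intro P
    induction P using MvPolynomial.induction_on with
    | C a => exact hc a
    | add p q hp hq => rw [map_add]; exact add_mem hp hq
    | mul_X p i hp => rw [map_mul]; exact mul_mem hp (ht i)
  have h2 : ∀ x : FractionRing (MvPolynomial (Fin n) Fbar), algebraMap _ (GenCl Fbar n) x ∈ k := by
    intro x
    obtain ⟨a, b, _, rfl⟩ := IsFractionRing.div_surjective (A := MvPolynomial (Fin n) Fbar) x
    rw [map_div₀]
    exact div_mem (h1 a) (h1 b)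
  let φ : FractionRing (MvPolynomial (Fin n) Fbar) →+* k :=
    (algebraMap _ (GenCl Fbar n)).codRestrict k h2
  letI := φ.toAlgebra
  haveI : IsScalarTower (FractionRing (MvPolynomial (Fin n) Fbar)) k (GenCl Fbar n) :=
    IsScalarTower.of_algebraMap_eq fun x => rfl
  exact Algebra.IsAlgebraic.tower_top (K := FractionRing (MvPolynomial (Fin n) Fbar)) k


/-- Let `q` be an odd prime power, `n ≥ 2`,
`P(t_1,…,t_n; x) = x^n + t_1 x^{n-1} + ⋯ + t_n` the generic polynomial with roots
`z_1, …, z_n` in an algebraic closure of `F̄_q(t_1, …, t_n)`, and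
`L = L_1 ⋯ L_n` a compositum of finite extensions `L_i / F̄_q(t_i)`.
Then `disc_x(P) = ∏_{i<j}(z_i − z_j)²` is not a square in `L`. -/
theorem disc_generic_not_square_in_decomposable
    (p k n : ℕ) [Fact p.Prime] (hp : Odd p) (hk : 0 < k) (hn : 2 ≤ n)
    (Fbar : Type*) [Field Fbar] [Algebra (GaloisField p k) Fbar]
    [IsAlgClosure (GaloisField p k) Fbar]
    (L : Fin n → Subfield (GenCl Fbar n))
    (hL : ∀ i, IsFiniteSubextension (oneVarSubfield Fbar n i) (L i))
    (z : Fin n → GenCl Fbar n)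
    (hz : (X ^ n + ∑ i : Fin n, C (genT Fbar n i) * X ^ (n - 1 - (i : ℕ)) :
        Polynomial (GenCl Fbar n)) = ∏ i : Fin n, (X - C (z i))) :
    ¬ ∃ y ∈ Subfield.closure (⋃ i, (L i : Set (GenCl Fbar n))),
        y ^ 2 = ∏ pr ∈ Finset.univ.filter (fun pr : Fin n × Fin n => pr.1 < pr.2),
          (z pr.1 - z pr.2) ^ 2 := by
  obtain ⟨m, rfl⟩ : ∃ m, n = m + 1 := ⟨n - 1, by omega⟩
  have hm : 1 ≤ m := by omega
  rintro ⟨y, hy, hysq⟩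
  have hcp : CharP Fbar p :=
    charP_of_injective_algebraMap (algebraMap (GaloisField p k) Fbar).injective p
  have hind := aux_ind Fbar (m + 1)
  let E := IntermediateField.adjoin Fbar
    (Set.range fun j : Fin m => genT Fbar (m + 1) j.castSucc)
  let A := algebraicClosure E (GenCl Fbar (m + 1))
  set b := genT Fbar (m + 1) (Fin.last m) with hbdef
  have hclA : IsAlgClosed A :=
    (algebraicClosure.isAlgClosure E (GenCl Fbar (m + 1))).isAlgClosed
  have htower : IsScalarTower Fbar A (GenCl Fbar (m + 1)) :=
    IsScalarTower.of_algebraMap_eq fun x => rfl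
  have hcpA : CharP A p := charP_of_injective_algebraMap (algebraMap Fbar A).injective p
  have hexp : ExpChar A p := ExpChar.prime Fact.out
  have h2 : (2 : A) ≠ 0 := by
    intro h0
    have : p ∣ 2 := by
      rw [← CharP.cast_eq_zero_iff A p]
      exact_mod_cast h0
    have := (Nat.prime_dvd_prime_iff_eq Fact.out Nat.prime_two).1 this
    rw [this] at hp
    exact absurd hp (by decide)
  have htE : ∀ j : Fin m, genT Fbar (m + 1) j.castSucc ∈ E := fun j =>
    IntermediateField.subset_adjoin _ _ ⟨j, rfl⟩
  let t : Fin m → A := fun j => algebraMap E A ⟨_, htE j⟩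
  have ht : AlgebraicIndependent Fbar t := by
    have h1 : AlgebraicIndependent Fbar (fun j : Fin m => genT Fbar (m + 1) j.castSucc) :=
      hind.comp _ (Fin.castSucc_injective m)
    exact AlgebraicIndependent.of_comp (IsScalarTower.toAlgHom Fbar A (GenCl Fbar (m + 1))) h1
  have hbE : Transcendental E b := by
    have h1 := hind.transcendental_adjoin (s := Set.range Fin.castSucc) (i := Fin.last m) (by
      rintro ⟨j, hj⟩
      exact absurd hj (Fin.castSucc_lt_last j).ne)
    rw [← Set.range_comp] at h1
    intro h3
    exact h1 (IntermediateField.isAlgebraic_adjoin_iff.1 h3)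
  have hbA : Transcendental A b := fun h1 => hbE (h1.restrictScalars E)
  let f : A[X] := X ^ (m + 1) + ∑ i : Fin m, C (t i) * X ^ (m - (i : ℕ))
  obtain ⟨hder, β, hβ, hmul⟩ := aux_geom (F := Fbar) h2 hm t ht f rfl
  have hz' : f.map (algebraMap A (GenCl Fbar (m + 1))) + C b = ∏ i, (X - C (z i)) := by
    rw [← hz, Fin.sum_univ_castSucc]
    simp only [f, Polynomial.map_add, Polynomial.map_pow, map_X, Polynomial.map_sum,
      Polynomial.map_mul, map_C, Fin.val_castSucc, Fin.val_last, Nat.add_sub_cancel, Nat.sub_self,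
      pow_zero, mul_one, add_assoc]
    rfl
  obtain ⟨u, hu, hdisc⟩ := aux_disc z b f hder hz'
  refine aux_core (F := Fbar) (A := A) p hp b hbA ?_ _ β ?_ hβ y ?_ (hysq.trans hdisc)
  · apply aux_alg
    · intro a
      exact (IntermediateField.adjoin A {b}).algebraMap_mem (algebraMap Fbar A a)
    · intro i
      induction i using Fin.lastCases with
      | last => exact IntermediateField.mem_adjoin_simple_self A b
      | cast j => exact (IntermediateField.adjoin A {b}).algebraMap_mem (t j)
  · have hne : C u * ((derivative f).roots.map (fun c => X - C (-(f.eval c)))).prod ≠ 0 := by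
      refine mul_ne_zero (by simpa using hu) ?_
      intro h0
      rw [h0] at hmul
      simp at hmul
    rw [rootMultiplicity_mul hne, hmul, rootMultiplicity_C]
  · refine (Subfield.closure_mono ?_) hy
    rw [Set.iUnion_subset_iff]
    intro i x hx
    induction i using Fin.lastCases with
    | last =>
      right
      exact aux_L _ _ _ (aux_oneVar Fbar (m + 1) _ _
        (IntermediateField.mem_adjoin_simple_self Fbar b)) (hL _) x hx
    | cast j =>
      left
      have := aux_L E _ _ (aux_oneVar Fbar (m + 1) _ _ (htE j)) (hL _) x hx
      exact ⟨⟨x, mem_algebraicClosure_iff.2 this⟩, rfl⟩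
end

section
/- Let q be an odd prime power, F = F_q(t_1,...,t_n), F_P the splitting field over F of the generic polynomial P = x^n + t_1 x^{n-1} + ... + t_n, and N/F a decomposable extension (a compositum N_1⋯N_n with N_i/F_q(t_i) finite). Then F_P and N are linearly disjoint over F. -/
open Polynomial

/-- The rational function field `F = F_q(t_1, …, t_n)`. -/
abbrev GenFF (p k n : ℕ) [Fact p.Prime] : Type _ :=
  FractionRing (MvPolynomial (Fin n) (GaloisField p k))

/-- A fixed algebraic closure of `F = F_q(t_1, …, t_n)`. -/
abbrev GenFFCl (p k n : ℕ) [Fact p.Prime] : Type _ :=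
  AlgebraicClosure (GenFF p k n)

/-- The indeterminate `t_i` as an element of `F = F_q(t_1, …, t_n)`. -/
noncomputable def genFFT (p k n : ℕ) [Fact p.Prime] (i : Fin n) : GenFF p k n :=
  algebraMap (MvPolynomial (Fin n) (GaloisField p k)) (GenFF p k n)
    (MvPolynomial.X i)

/-- The generic polynomial `P = x^n + t_1 x^{n-1} + ⋯ + t_n` over `F`. -/
noncomputable def genericPoly (p k n : ℕ) [Fact p.Prime] :
    Polynomial (GenFF p k n) :=
  X ^ n + ∑ i : Fin n, C (genFFT p k n i) * X ^ (n - 1 - (i : ℕ))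

/-- The copy of `F_q` (the constants) inside the algebraic closure of `F`. -/
noncomputable def constFFSubfield (p k n : ℕ) [Fact p.Prime] :
    Subfield (GenFFCl p k n) :=
  ((algebraMap (GenFF p k n) (GenFFCl p k n)).comp
    ((algebraMap (MvPolynomial (Fin n) (GaloisField p k)) (GenFF p k n)).comp
      (MvPolynomial.C : GaloisField p k →+* MvPolynomial (Fin n) (GaloisField p k)))).fieldRange

/-- The subfield `F_q(t_i)` of the algebraic closure of `F`. -/
noncomputable def oneVarFFSubfield (p k n : ℕ) [Fact p.Prime] (i : Fin n) :
    Subfield (GenFFCl p k n) :=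
  Subfield.closure ((constFFSubfield p k n : Set (GenFFCl p k n)) ∪
    {algebraMap (GenFF p k n) (GenFFCl p k n) (genFFT p k n i)})

theorem aux_insep {k0 K : Type*} [Field k0] [Field K] (p : ℕ) [Fact p.Prime] [CharP k0 p]
    (θ : k0 →+* K) (z : K) (f : k0[X]) (hf : f ≠ 0) (hz : eval₂ θ z f = 0) :
    ∃ (m : ℕ) (g : k0[X]), g.Monic ∧ g.Separable ∧ eval₂ θ (z ^ p ^ m) g = 0 := by
  let := θ.toAlgebra
  have hz' : IsAlgebraic k0 z := ⟨f, hf, hz⟩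
  have hi : Irreducible (minpoly k0 z) := minpoly.irreducible hz'.isIntegral
  obtain ⟨g, hg, m, hm⟩ := hi.hasSeparableContraction p
  have hg0 : g ≠ 0 := hg.ne_zero
  have hlc : g.leadingCoeff ≠ 0 := by simpa using hg0
  refine ⟨m, C g.leadingCoeff⁻¹ * g, ?_, ?_, ?_⟩
  · rw [mul_comm]; exact monic_mul_leadingCoeff_inv hg0
  · refine hg.of_dvd ⟨C g.leadingCoeff, ?_⟩
    rw [mul_comm, ← mul_assoc, ← C_mul, mul_inv_cancel₀ hlc, C_1, one_mul]
  · have h1 : aeval z (minpoly k0 z) = 0 := minpoly.aeval k0 z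
    rw [← hm, expand_aeval] at h1
    rw [eval₂_mul]
    have : eval₂ θ (z ^ p ^ m) g = 0 := h1
    rw [this, mul_zero]

theorem aux_hensel {k0 E Ω : Type*} [Field k0] [Field E] [IsAlgClosed E] [Field Ω]
    (θ : k0 →+* PowerSeries E) (Ψ : PowerSeries E →+* PowerSeries E)
    (hΨ : ∀ a, Ψ (θ a) = θ a)
    (hc : ∀ f, PowerSeries.constantCoeff (Ψ f) = PowerSeries.constantCoeff f)
    (j : PowerSeries E →+* Ω) (f : k0[X]) (hm : f.Monic) (hs : f.Separable) (w : Ω)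
    (hw : eval₂ (j.comp θ) w f = 0) : ∃ r, Ψ r = r ∧ j r = w := by
  classical
  set F := f.map θ with hF
  set c : PowerSeries E →+* E := PowerSeries.constantCoeff with hcdef
  have hFm : F.Monic := hm.map θ
  set fb := f.map (c.comp θ) with hfb
  have hfbF : fb = F.map c := by rw [hfb, hF, Polynomial.map_map]
  have hsb : fb.Separable := hs.map
  have hfbm : fb.Monic := hm.map _
  have hev : ∀ (a : E) (G : (PowerSeries E)[X]), c (eval (PowerSeries.C a) G) =
      eval (c (PowerSeries.C a)) (G.map c) := fun a G => by rw [eval_map, eval₂_hom]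
  have hlift : ∀ a ∈ fb.roots.toFinset, ∃ r, F.IsRoot r ∧ c r = a := by
    intro a ha
    rw [Multiset.mem_toFinset, mem_roots hfbm.ne_zero] at ha
    have key := HenselianRing.is_henselian (I := Ideal.span {(PowerSeries.X : PowerSeries E)})
      F hFm (PowerSeries.C a) ?_ ?_
    · obtain ⟨r, hr, hr'⟩ := key
      refine ⟨r, hr, ?_⟩
      rw [Ideal.mem_span_singleton, PowerSeries.X_dvd_iff] at hr'
      simpa [sub_eq_zero] using hr'
    · rw [Ideal.mem_span_singleton, PowerSeries.X_dvd_iff]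
      have : c (eval (PowerSeries.C a) F) = eval (c (PowerSeries.C a)) (F.map c) := by
        exact hev a F
      change c _ = 0
      rw [this, ← hfbF]; simpa [c] using ha
    · apply IsUnit.map
      rw [PowerSeries.isUnit_iff_constantCoeff]
      have : c (eval (PowerSeries.C a) (derivative F)) = eval (c (PowerSeries.C a)) (derivative (F.map c)) := by
        rw [hev, ← derivative_map F c]
      change IsUnit (c _)
      rw [this, ← hfbF, isUnit_iff_ne_zero]
      have := hsb.eval₂_derivative_ne_zero (RingHom.id E) (x := a) (by simpa using ha)
      simpa [c] using this
  choose! r hr hra using hlift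
  have hinj : Set.InjOn r fb.roots.toFinset := fun a ha b hb hab => by
    rw [← hra a ha, ← hra b hb, hab]
  have hprod : F = ∏ a ∈ fb.roots.toFinset, (X - C (r a)) := by
    apply eq_of_monic_of_dvd_of_natDegree_le
    · exact monic_prod_of_monic _ _ fun a _ => monic_X_sub_C (r a)
    · exact hFm
    · apply Finset.prod_dvd_of_coprime
      · intro a ha b hb hab
        apply isCoprime_X_sub_C_of_isUnit_sub
        rw [PowerSeries.isUnit_iff_constantCoeff, isUnit_iff_ne_zero]
        change c _ ≠ 0
        rw [map_sub, hra a ha, hra b hb]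
        exact sub_ne_zero.2 hab
      · intro a ha
        exact dvd_iff_isRoot.2 (hr a ha)
    · rw [natDegree_prod_of_monic _ _ fun a _ => monic_X_sub_C (r a)]
      simp only [natDegree_X_sub_C, Finset.sum_const, smul_eq_mul, mul_one]
      rw [Multiset.toFinset_card_of_nodup (nodup_roots hsb), 
        (splits_iff_card_roots.1 (IsAlgClosed.splits fb)), hfb, hF, hm.natDegree_map, hm.natDegree_map]
  have hroot : ∀ {T : Type _} [Field T] (g : PowerSeries E →+* T) (t : T), eval₂ g t F = 0 →
     ∃ a ∈ fb.roots.toFinset, g (r a) = t := by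
    intro T _ g t ht
    rw [hprod, eval₂_finsetProd, Finset.prod_eq_zero_iff] at ht
    obtain ⟨a, ha, h⟩ := ht
    refine ⟨a, ha, ?_⟩
    simp [sub_eq_zero] at h
    exact h.symm
  obtain ⟨a, ha, h⟩ := hroot j w (by rw [hF, eval₂_map]; exact hw)
  refine ⟨r a, ?_, h⟩
  have h2 : eval (Ψ (r a)) F = 0 := by
    have := congrArg Ψ (hr a ha)
    rw [eval, hom_eval₂, map_zero, hF, eval₂_map] at this
    rw [hF, eval_map]
    convert this using 2
    ext1 b; simp [hΨ]
  rw [hprod, eval_prod, Finset.prod_eq_zero_iff] at h2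
  obtain ⟨a', ha', h'⟩ := h2
  simp [sub_eq_zero] at h'
  have : a' = a := by rw [← hra a ha, ← hra a' ha', ← h']; exact (hc _)
  rw [h', this]

theorem aux_lift {A C Ω : Type*} [CommRing A] [IsDomain A] [Field C] [Field Ω] [IsAlgClosed Ω]
    (i : A →+* C) (j : A →+* Ω) (hi : Function.Injective i) (hj : Function.Injective j)
    (halg : ∀ c : C, ∃ f : A[X], f ≠ 0 ∧ eval₂ i c f = 0) :
    ∃ φ : C →+* Ω, ∀ a, φ (i a) = j a := by
  let := i.toAlgebra
  let := j.toAlgebra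
  have : FaithfulSMul A C := (faithfulSMul_iff_algebraMap_injective A C).2 hi
  have : FaithfulSMul A Ω := (faithfulSMul_iff_algebraMap_injective A Ω).2 hj
  have : Algebra.IsAlgebraic A C := ⟨fun c => halg c⟩
  exact ⟨(IsAlgClosed.lift : C →ₐ[A] Ω).toRingHom, fun a => (IsAlgClosed.lift : C →ₐ[A] Ω).commutes a⟩


theorem aux_transc {k : Type*} [Field k] (h2 : (2 : k) ≠ 0) (n : ℕ) (i j : Fin n) (hij : i ≠ j)
    (m : Fin n) :
    Transcendental k (MvPolynomial.aeval
      (fun l => if l = j then (MvPolynomial.X i : MvPolynomial (Fin n) k) else MvPolynomial.X l)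
      (MvPolynomial.esymm (Fin n) k (m + 1))) := by
  classical
  obtain ⟨S, hS, hScard⟩ : ∃ S : Finset (Fin n), {i, j} ⊆ S ∧ (S.card = m + 1 ∨ S = {i, j} ∧ (m : ℕ) = 0) := by
    by_cases hm : (m : ℕ) = 0
    · exact ⟨{i, j}, subset_rfl, Or.inr ⟨rfl, hm⟩⟩
    · obtain ⟨S, h1, h2⟩ := Finset.exists_superset_card_eq (s := {i, j}) (n := m + 1)
        (by rw [Finset.card_pair hij]; omega) (by simp)
      exact ⟨S, h1, Or.inl h2⟩
  have hiS : i ∈ S := hS (by simp)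
  have hjS : j ∈ S := hS (by simp)
  let ev : MvPolynomial (Fin n) k →ₐ[k] k[X] :=
    MvPolynomial.aeval (fun l => if l ∈ S then X else 0)
  have hev : ev (MvPolynomial.aeval
      (fun l => if l = j then (MvPolynomial.X i : MvPolynomial (Fin n) k) else MvPolynomial.X l)
      (MvPolynomial.esymm (Fin n) k (m + 1))) = 
      ∑ T ∈ Finset.powersetCard (m + 1) Finset.univ, ∏ l ∈ T, (if l ∈ S then (X : k[X]) else 0) := by
    rw [MvPolynomial.esymm, map_sum, map_sum]
    refine Finset.sum_congr rfl fun T _ => ?_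
    rw [map_prod, map_prod]
    refine Finset.prod_congr rfl fun l _ => ?_
    by_cases hl : l = j
    · simp [hl, ev, hiS, hjS]
    · simp [hl, ev]
  have htr : Transcendental k (∑ T ∈ Finset.powersetCard (m + 1) Finset.univ,
      ∏ l ∈ T, (if l ∈ S then (X : k[X]) else 0)) := by
    rcases hScard with hc | ⟨hSe, hm⟩
    · rw [Finset.sum_eq_single S]
      · rw [Finset.prod_congr rfl (g := fun _ => X) (fun l hl => if_pos hl), Finset.prod_const, hc]
        exact (transcendental_X k).pow (by omega)
      · intro T hT hTS
        rw [Finset.mem_powersetCard] at hT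
        obtain ⟨l, hl, hlS⟩ : ∃ l ∈ T, l ∉ S := by
          by_contra! hcon
          exact hTS (Finset.eq_of_subset_of_card_le hcon (by omega))
        exact Finset.prod_eq_zero hl (if_neg hlS)
      · intro h; exact absurd (Finset.mem_powersetCard.2 ⟨Finset.subset_univ _, hc⟩) h
    · have : (∑ T ∈ Finset.powersetCard (m + 1) Finset.univ,
        ∏ l ∈ T, (if l ∈ S then (X : k[X]) else 0)) = aeval X (C (2 : k) * X) := by
        rw [hm, zero_add, Finset.powersetCard_one, Finset.sum_map]
        simp only [Function.Embedding.coeFn_mk, Finset.prod_singleton]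
        rw [← Finset.sum_filter]
        rw [Finset.filter_univ_mem, Finset.sum_const, hSe, Finset.card_pair hij]
        simp [← one_add_one_eq_two, add_mul]
      rw [this]
      refine (transcendental_X k).aeval _ ?_ ?_
      · rw [natDegree_C_mul_X _ h2]; exact one_ne_zero
      · rw [mem_nonZeroDivisors_iff_ne_zero, leadingCoeff_ne_zero]
        exact mul_ne_zero (C_ne_zero.2 h2) X_ne_zero
  rw [← hev] at htr
  intro hal
  exact htr (hal.algHom ev)

theorem aux_inj {k E : Type*} [Field k] [Field E] [Algebra k E] (h2 : (2 : k) ≠ 0) (n : ℕ)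
    (b : Fin n → E) (hb : AlgebraicIndependent k b) (i j : Fin n) (hij : i ≠ j) :
    Function.Injective (MvPolynomial.aeval (R := k) (fun l => PowerSeries.C (if l = j then b i else b l) +
      PowerSeries.C (if l = i then 1 else if l = j then -1 else 0) * PowerSeries.X :
        Fin n → PowerSeries E)) := by
  classical
  let γ : MvPolynomial (Fin n) k →ₐ[k] (MvPolynomial (Fin n) k)[X] :=
    MvPolynomial.aeval (fun l => C (if l = j then MvPolynomial.X i else MvPolynomial.X l) +
      C (if l = i then 1 else if l = j then -1 else 0) * X)
  let c : MvPolynomial (Fin n) k := MvPolynomial.C (2 : k)⁻¹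
  have hc : c * 2 = 1 := by
    have : (2 : MvPolynomial (Fin n) k) = MvPolynomial.C 2 := (map_ofNat MvPolynomial.C 2).symm
    rw [this, ← MvPolynomial.C_mul, inv_mul_cancel₀ h2, MvPolynomial.C_1]
  let δ : MvPolynomial (Fin n) k →ₐ[k] MvPolynomial (Fin n) k :=
    MvPolynomial.aeval (fun l => if l = i then c * (MvPolynomial.X i + MvPolynomial.X j)
      else MvPolynomial.X l)
  let δ' : (MvPolynomial (Fin n) k)[X] →+* MvPolynomial (Fin n) k :=
    eval₂RingHom δ.toRingHom (c * (MvPolynomial.X i - MvPolynomial.X j))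
  have hγ : Function.Injective γ := by
    have : δ'.comp γ.toRingHom = RingHom.id _ := by
      apply MvPolynomial.ringHom_ext
      · intro a
        simp [γ, δ', δ, IsScalarTower.algebraMap_apply k (MvPolynomial (Fin n) k) (MvPolynomial (Fin n) k)[X]]
      · intro l
        by_cases hl : l = i
        · subst hl
          simp [γ, δ', δ, hij]
          linear_combination (MvPolynomial.X l) * hc
        · by_cases hl' : l = j
          · subst hl'
            simp [γ, δ', δ, hl]
            linear_combination (MvPolynomial.X l) * hc
          · simp [γ, δ', δ, hl, hl']
    exact Function.LeftInverse.injective (g := δ') (fun x => RingHom.congr_fun this x)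
  set β := (MvPolynomial.aeval (R := k) (fun l => PowerSeries.C (if l = j then b i else b l) +
      PowerSeries.C (if l = i then 1 else if l = j then -1 else 0) * PowerSeries.X :
        Fin n → PowerSeries E)) with hβ
  have hcomp : β.toRingHom = (Polynomial.coeToPowerSeries.ringHom.comp
          (Polynomial.mapRingHom (MvPolynomial.aeval b).toRingHom)).comp γ.toRingHom := by
    apply MvPolynomial.ringHom_ext
    · intro a
      simp [β, γ, IsScalarTower.algebraMap_apply k (MvPolynomial (Fin n) k) (MvPolynomial (Fin n) k)[X]]
      exact PowerSeries.algebraMap_apply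
    · intro l
      by_cases hl : l = i
      · subst hl
        simp [β, γ, hij]
      · by_cases hl' : l = j
        · subst hl'
          simp [β, γ, hl]
        · simp [β, γ, hl, hl']
  intro f g hfg
  have hfg' : β.toRingHom f = β.toRingHom g := hfg
  rw [hcomp] at hfg'
  exact hγ (Polynomial.map_injective _ hb (Polynomial.coe_injective E hfg'))



theorem aux_key.{u} {k C : Type*} {E : Type u} [Field k] [Field C] [Algebra k C] [Field E] [Algebra k E]
    [IsAlgClosed E] (p : ℕ) [Fact p.Prime] [CharP k p] (h2 : (2 : k) ≠ 0) (n : ℕ)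
    (x : Fin n → C) (hx : AlgebraicIndependent k x)
    (halg : ∀ c : C, ∃ f : (MvPolynomial (Fin n) k)[X], f ≠ 0 ∧
      eval₂ (MvPolynomial.aeval x).toRingHom c f = 0)
    (b : Fin n → E) (hb : AlgebraicIndependent k b) (i j : Fin n) (hij : i ≠ j) :
    ∃ (Ω : Type u) (_ : Field Ω) (φ φ' : C →+* Ω),
      (∀ a : k, φ (algebraMap k C a) = φ' (algebraMap k C a)) ∧
      (∀ f : MvPolynomial (Fin n) k, φ' (MvPolynomial.aeval x f) =
        φ (MvPolynomial.aeval x (MvPolynomial.rename (Equiv.swap i j) f))) ∧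
      ∀ (m : Fin n) (θ : FractionRing k[X] →+* C),
        (∀ g : k[X], θ (algebraMap k[X] (FractionRing k[X]) g) =
          aeval (MvPolynomial.aeval x (MvPolynomial.esymm (Fin n) k (m + 1))) g) →
        ∀ (z : C) (f : (FractionRing k[X])[X]), f ≠ 0 → eval₂ θ z f = 0 → φ z = φ' z := by
  classical
  set β := (MvPolynomial.aeval (R := k) (fun l => PowerSeries.C (if l = j then b i else b l) +
      PowerSeries.C (if l = i then 1 else if l = j then -1 else 0) * PowerSeries.X :
        Fin n → PowerSeries E)) with hβ
  have hβinj : Function.Injective β := aux_inj h2 n b hb i j hij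
  let Ψ : PowerSeries E →+* PowerSeries E := PowerSeries.evalNegHom
  have hΨC : ∀ a, Ψ (PowerSeries.C a) = PowerSeries.C a := by
    intro a; ext m; simp [Ψ, PowerSeries.evalNegHom, PowerSeries.coeff_C]
    split_ifs with h <;> simp [h]
  have hΨX : Ψ PowerSeries.X = - PowerSeries.X := PowerSeries.evalNegHom_X
  have hΨc : ∀ f, PowerSeries.constantCoeff (Ψ f) = PowerSeries.constantCoeff f := by
    intro f
    rw [← PowerSeries.coeff_zero_eq_constantCoeff_apply, ← PowerSeries.coeff_zero_eq_constantCoeff_apply]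
    simp [Ψ, PowerSeries.evalNegHom]
  have hΨinv : ∀ f, Ψ (Ψ f) = f := by
    intro f; ext m; simp [Ψ, PowerSeries.evalNegHom, ← mul_assoc, ← mul_pow]
  have hΨinj : Function.Injective Ψ := Function.LeftInverse.injective hΨinv
  have hΨβ : ∀ f, Ψ (β f) = β (MvPolynomial.rename (Equiv.swap i j) f) := by
    have : Ψ.comp β.toRingHom = β.toRingHom.comp
        (MvPolynomial.rename (R := k) (Equiv.swap i j)).toRingHom := by
      apply MvPolynomial.ringHom_ext
      · intro a
        simp [β, PowerSeries.algebraMap_apply, hΨC]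
      · intro l
        by_cases hl : l = i
        · subst hl
          simp [β, hij, hij.symm, hΨC, hΨX]
        · by_cases hl' : l = j
          · subst hl'
            simp [β, hl, hΨC, hΨX, hij]
          · simp [β, hl, hl', Equiv.swap_apply_of_ne_of_ne hl hl', hΨC]
    exact fun f => RingHom.congr_fun this f
  let Q := FractionRing (PowerSeries E)
  let Ω := AlgebraicClosure Q
  let J : PowerSeries E →+* Ω := (algebraMap Q Ω).comp (algebraMap (PowerSeries E) Q)
  have hJ : Function.Injective J :=
    (algebraMap Q Ω).injective.comp (IsFractionRing.injective (PowerSeries E) Q)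
  have hJalg : ∀ w : Ω, ∃ f : (PowerSeries E)[X], f ≠ 0 ∧ eval₂ J w f = 0 := by
    intro w
    have h1 : IsAlgebraic Q w := Algebra.IsAlgebraic.isAlgebraic w
    have h2 : IsAlgebraic (PowerSeries E) w :=
      (IsFractionRing.isAlgebraic_iff (PowerSeries E) Q Ω).2 h1
    obtain ⟨f, hf, hf'⟩ := h2
    exact ⟨f, hf, hf'⟩
  obtain ⟨φ, hφ⟩ := aux_lift (MvPolynomial.aeval x).toRingHom (J.comp β.toRingHom)
    (show Function.Injective (MvPolynomial.aeval x) from hx)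
    (hJ.comp hβinj) halg
  obtain ⟨Ψ', hΨ'⟩ := aux_lift J (J.comp Ψ) hJ (hJ.comp hΨinj) hJalg
  have hφ1 : ∀ f, φ (MvPolynomial.aeval x f) = J (β f) := hφ
  have hφ2 : ∀ f : MvPolynomial (Fin n) k, Ψ' (φ (MvPolynomial.aeval x f)) =
      φ (MvPolynomial.aeval x (MvPolynomial.rename (Equiv.swap i j) f)) := by
    intro f
    rw [hφ1, hΨ', hφ1, ← hΨβ]; rfl
  refine ⟨Ω, inferInstance, φ, Ψ'.comp φ, ?_, hφ2, ?_⟩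
  · intro a
    have := hφ2 (MvPolynomial.C a)
    simp only [MvPolynomial.rename_C, MvPolynomial.aeval_C] at this
    exact this.symm
  intro m θ hθ z f hf hz
  have : CharP (FractionRing k[X]) p := charP_of_injective_algebraMap (algebraMap k (FractionRing k[X])).injective p
  have : CharP C p := charP_of_injective_algebraMap (algebraMap k C).injective p
  have : CharP Ω p := charP_of_injective_ringHom φ.injective p
  obtain ⟨r, g, hgm, hgs, hgz⟩ := aux_insep p θ z f hf hz
  set e := MvPolynomial.esymm (Fin n) k (m + 1) with he
  have hte : Transcendental k (PowerSeries.constantCoeff (β e)) := by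
    have h1 := aux_transc h2 n i j hij m
    rw [← he] at h1
    have h3 : PowerSeries.constantCoeff (β e) = MvPolynomial.aeval b (MvPolynomial.aeval
      (fun l => if l = j then (MvPolynomial.X i : MvPolynomial (Fin n) k) else MvPolynomial.X l) e) := by
      have : (PowerSeries.constantCoeff).comp β.toRingHom = ((MvPolynomial.aeval b).comp (MvPolynomial.aeval
        (fun l => if l = j then (MvPolynomial.X i : MvPolynomial (Fin n) k) else MvPolynomial.X l))).toRingHom := by
        apply MvPolynomial.ringHom_ext
        · intro a
          simp [β, PowerSeries.algebraMap_apply]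
        · intro l
          by_cases hl : l = j <;> by_cases hl' : l = i <;> simp [β, hl, hl']
      exact RingHom.congr_fun this e
    rw [h3]
    intro hal
    exact h1 ((isAlgebraic_algHom_iff (MvPolynomial.aeval b) hb).1 hal)
  let θ0 : k[X] →+* PowerSeries E := (aeval (β e)).toRingHom
  have hunit : ∀ y : nonZeroDivisors k[X], IsUnit (θ0 y) := by
    rintro ⟨y, hy⟩
    rw [mem_nonZeroDivisors_iff_ne_zero] at hy
    rw [PowerSeries.isUnit_iff_constantCoeff, isUnit_iff_ne_zero]
    intro h
    apply hte
    refine ⟨y, hy, ?_⟩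
    rw [← h]
    change _ = PowerSeries.constantCoeff (aeval (β e) y)
    rw [aeval_def (β e), hom_eval₂, aeval_def]
    congr 1
  let θ' : FractionRing k[X] →+* PowerSeries E := IsLocalization.lift hunit
  have hθ' : ∀ y, θ' (algebraMap _ _ y) = θ0 y := fun y => IsLocalization.lift_eq hunit y
  have hΨθ : ∀ a, Ψ (θ' a) = θ' a := by
    have : Ψ.comp θ' = θ' := by
      apply IsLocalization.ringHom_ext (nonZeroDivisors k[X])
      apply Polynomial.ringHom_ext
      · intro a
        simp only [RingHom.comp_apply, hθ']
        simp [θ0, PowerSeries.algebraMap_apply, hΨC]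
      · simp only [RingHom.comp_apply, hθ']
        simp only [θ0, AlgHom.toRingHom_eq_coe, RingHom.coe_coe, aeval_X, hΨβ]
        rw [he, MvPolynomial.rename_esymm]
    exact fun a => RingHom.congr_fun this a
  have hcompat : φ.comp θ = J.comp θ' := by
    apply IsLocalization.ringHom_ext (nonZeroDivisors k[X])
    apply RingHom.ext
    intro y
    simp only [RingHom.comp_apply, hθ', hθ]
    rw [aeval_algHom_apply, hφ1]
    change _ = J (aeval (β e) y)
    rw [aeval_algHom_apply]
  obtain ⟨s, hs1, hs2⟩ := aux_hensel θ' Ψ hΨθ hΨc J g hgm hgs (φ (z ^ p ^ r)) (by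
    rw [← hcompat, ← hom_eval₂, hgz, map_zero])
  have hfin : φ z ^ p ^ r = (Ψ'.comp φ) z ^ p ^ r := by
    rw [← map_pow, ← map_pow, RingHom.comp_apply, ← hs2, hΨ']
    change J s = J (Ψ s)
    rw [hs1]
  exact iterateFrobenius_inj Ω p r hfin


theorem aux_sym {k : Type*} [Field k] (n : ℕ) (f g : MvPolynomial (Fin n) k) (hg : g ≠ 0)
    (h : ∀ i j, i ≠ j → f * MvPolynomial.rename (Equiv.swap i j) g =
      MvPolynomial.rename (Equiv.swap i j) f * g) :
    ∃ F G : MvPolynomial (Fin n) k,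
      MvPolynomial.aeval (fun i : Fin n => MvPolynomial.esymm (Fin n) k (i + 1)) G ≠ 0 ∧
      f * MvPolynomial.aeval (fun i : Fin n => MvPolynomial.esymm (Fin n) k (i + 1)) G =
      g * MvPolynomial.aeval (fun i : Fin n => MvPolynomial.esymm (Fin n) k (i + 1)) F := by
  classical
  have hren : ∀ σ : Equiv.Perm (Fin n), MvPolynomial.rename σ g ≠ 0 := fun σ => by
    rw [Ne, MvPolynomial.rename_eq_zero_iff_of_injective _ σ.injective]; exact hg
  have hall : ∀ σ : Equiv.Perm (Fin n), f * MvPolynomial.rename σ g = MvPolynomial.rename σ f * g := by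
    intro σ
    induction σ using Equiv.Perm.swap_induction_on with
    | one => simp
    | swap_mul τ i j hij ih =>
      have h1 := congrArg (MvPolynomial.rename (Equiv.swap i j)) ih
      simp only [map_mul, MvPolynomial.rename_rename] at h1
      have h2 := h i j hij
      apply mul_right_cancel₀ (hren (Equiv.swap i j))
      rw [Equiv.Perm.coe_mul]
      linear_combination (MvPolynomial.rename (Equiv.swap i j ∘ τ) g) * h2 + g * h1
  let G0 := ∏ σ : Equiv.Perm (Fin n), MvPolynomial.rename σ g
  have hG0 : G0 ≠ 0 := Finset.prod_ne_zero_iff.2 fun σ _ => hren σ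
  have hG0s : G0.IsSymmetric := by
    intro τ
    simp only [G0, map_prod, MvPolynomial.rename_rename]
    exact Fintype.prod_equiv (Equiv.mulLeft τ) _ _ (fun σ => by simp)
  obtain ⟨w, hw⟩ : g ∣ G0 := by
    have := Finset.dvd_prod_of_mem (fun σ : Equiv.Perm (Fin n) => MvPolynomial.rename σ g)
      (Finset.mem_univ 1)
    simpa using this
  have hHs : (f * w).IsSymmetric := by
    intro τ
    have h1 := congrArg (MvPolynomial.rename τ) hw
    rw [hG0s τ, map_mul] at h1
    have h2 := hall τ
    apply mul_right_cancel₀ (mul_ne_zero (hren τ) hg)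
    rw [map_mul]
    linear_combination (-(MvPolynomial.rename τ f * g)) * h1 +
      (f * MvPolynomial.rename τ g) * hw - G0 * h2
  have hsurj := (MvPolynomial.esymmAlgHom_fin_bijective (R := k) n).2
  obtain ⟨G, hG⟩ := hsurj ⟨G0, hG0s⟩
  obtain ⟨F, hF⟩ := hsurj ⟨f * w, hHs⟩
  have hG' := congrArg Subtype.val hG
  have hF' := congrArg Subtype.val hF
  rw [MvPolynomial.esymmAlgHom_apply] at hG' hF'
  refine ⟨F, G, ?_, ?_⟩
  · rw [hG']; exact hG0
  · rw [hG', hF']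
    change f * G0 = g * (f * w)
    rw [hw]; ring

theorem aux_indep {k C : Type*} [Field k] [Field C] [Algebra k C] (n : ℕ) (x : Fin n → C)
    (h : AlgebraicIndependent k (fun i : Fin n =>
      MvPolynomial.aeval x (MvPolynomial.esymm (Fin n) k (i + 1)))) : AlgebraicIndependent k x := by
  classical
  rw [algebraicIndependent_iff]
  intro f hf
  by_contra hf0
  let G0 := ∏ σ : Equiv.Perm (Fin n), MvPolynomial.rename σ f
  have hG0 : G0 ≠ 0 := Finset.prod_ne_zero_iff.2 fun σ _ => by
    rw [Ne, MvPolynomial.rename_eq_zero_iff_of_injective _ σ.injective]; exact hf0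
  have hG0s : G0.IsSymmetric := by
    intro τ
    simp only [G0, map_prod, MvPolynomial.rename_rename]
    exact Fintype.prod_equiv (Equiv.mulLeft τ) _ _ (fun σ => by simp)
  obtain ⟨G, hG⟩ := (MvPolynomial.esymmAlgHom_fin_bijective (R := k) n).2 ⟨G0, hG0s⟩
  have hG' := congrArg Subtype.val hG
  rw [MvPolynomial.esymmAlgHom_apply] at hG'
  have h0 : MvPolynomial.aeval x G0 = 0 := by
    simp only [G0, map_prod]
    apply Finset.prod_eq_zero (Finset.mem_univ 1)
    simpa using hf
  have h1 : G = 0 := by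
    rw [algebraicIndependent_iff] at h
    apply h
    rw [← h0]
    change _ = MvPolynomial.aeval x (Subtype.val (⟨G0, hG0s⟩ : MvPolynomial.symmetricSubalgebra (Fin n) k))
    rw [← hG', MvPolynomial.comp_aeval_apply]
  rw [h1, map_zero] at hG'
  exact hG0 hG'.symm

theorem aux_roots {C : Type*} [Field C] [IsAlgClosed C] (n : ℕ) (P : C[X]) (hP : P.Monic)
    (hn : P.natDegree = n) : ∃ x : Fin n → C, P = ∏ l, (X + Polynomial.C (x l)) := by
  have hs := IsAlgClosed.splits P
  have hcard : P.roots.card = n := by rw [splits_iff_card_roots.1 hs, hn]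
  have hl : P.roots.toList.length = n := by simp [hcard]
  subst hl
  refine ⟨fun l => - P.roots.toList.get l, ?_⟩
  have h1 := prod_multiset_X_sub_C_of_monic_of_roots_card_eq hP (by rw [hcard, hn])
  conv_lhs => rw [← h1, ← Multiset.coe_toList P.roots]
  rw [Multiset.map_coe, Multiset.prod_coe, ← List.ofFn_getElem_eq_map, List.prod_ofFn]
  simp [sub_eq_add_neg]


theorem aux_main {k F C : Type*} [Field k] [Field F] [Field C] (p : ℕ) [Fact p.Prime] [CharP k p]
    (h2 : (2 : k) ≠ 0) (n : ℕ)
    [Algebra (MvPolynomial (Fin n) k) F] [IsFractionRing (MvPolynomial (Fin n) k) F]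
    [Algebra F C] [IsAlgClosed C] [Algebra.IsAlgebraic F C] [Algebra k C]
    (hk : ∀ a : k, algebraMap k C a = algebraMap F C (algebraMap (MvPolynomial (Fin n) k) F
      (MvPolynomial.C a)))
    (t : Fin n → F) (ht : ∀ i, t i = algebraMap (MvPolynomial (Fin n) k) F (MvPolynomial.X i))
    (P : F[X]) (hP : P = X ^ n + ∑ i : Fin n, Polynomial.C (t i) * X ^ (n - 1 - (i : ℕ)))
    (E Ni : Fin n → Subfield C)
    (hE : ∀ i, E i = Subfield.closure (Set.range (algebraMap k C) ∪ {algebraMap F C (t i)}))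
    (hNi : ∀ i, IsFiniteSubextension (E i) (Ni i))
    (N : IntermediateField F C)
    (hN : N.toSubfield = Subfield.closure (⋃ i, (Ni i : Set C)))
    (FP : IntermediateField F C)
    (hFP : FP = IntermediateField.adjoin F (P.rootSet C)) :
    FP.LinearDisjoint N := by
  classical
  -- the generic polynomial is monic of degree `n`
  have hdeg : (∑ i : Fin n, Polynomial.C (t i) * X ^ (n - 1 - (i : ℕ))).degree < (n : WithBot ℕ) := by
    refine (degree_sum_le _ _).trans_lt ?_
    refine (Finset.sup_lt_iff (WithBot.bot_lt_coe n)).2 ?_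
    intro i _
    refine (degree_C_mul_X_pow_le _ _).trans_lt ?_
    have := i.2
    exact WithBot.coe_lt_coe.2 (by omega : n - 1 - (i : ℕ) < n)
  have hPm : P.Monic := by rw [hP]; exact monic_X_pow_add hdeg
  have hPn : P.natDegree = n := by
    rw [hP, natDegree_add_eq_left_of_degree_lt (by rw [degree_X_pow]; exact hdeg), natDegree_X_pow]
  have hPc : ∀ i : Fin n, P.coeff (n - 1 - (i : ℕ)) = t i := by
    intro i
    have hi := i.2
    rw [hP, coeff_add, coeff_X_pow, if_neg (by omega), zero_add, finsetSum_coeff,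
      Finset.sum_eq_single i]
    · simp
    · intro l _ hl
      have hl2 := l.2
      have : (l : ℕ) ≠ i := fun h => hl (Fin.ext h)
      rw [coeff_C_mul, coeff_X_pow, if_neg (by omega), mul_zero]
    · simp
  -- the roots
  obtain ⟨x, hx⟩ := aux_roots n (P.map (algebraMap F C)) (hPm.map _)
    (by rw [hPm.natDegree_map, hPn])
  have hte : ∀ i : Fin n, algebraMap F C (t i) =
      MvPolynomial.aeval x (MvPolynomial.esymm (Fin n) k (i + 1)) := by
    intro i
    have hi := i.2
    have h1 : (P.map (algebraMap F C)).coeff (n - 1 - (i : ℕ)) = algebraMap F C (t i) := by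
      rw [coeff_map, hPc]
    rw [← h1, hx, MvPolynomial.aeval_esymm_eq_multiset_esymm]
    have h3 := Multiset.prod_X_add_C_coeff ((Finset.univ : Finset (Fin n)).val.map x)
      (k := n - 1 - (i : ℕ)) (by simp; omega)
    rw [Multiset.map_map] at h3
    have h4 : Multiset.card ((Finset.univ : Finset (Fin n)).val.map x) - (n - 1 - (i : ℕ)) = i + 1 := by
      simp; omega
    rw [h4] at h3
    exact h3
  let T : MvPolynomial (Fin n) k →+* C := (algebraMap F C).comp (algebraMap (MvPolynomial (Fin n) k) F)
  let es : MvPolynomial (Fin n) k →ₐ[k] MvPolynomial (Fin n) k :=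
    MvPolynomial.aeval (fun i : Fin n => MvPolynomial.esymm (Fin n) k (i + 1))
  have hTinj : Function.Injective T :=
    (algebraMap F C).injective.comp (IsFractionRing.injective _ F)
  have hTe : ∀ f, T f = MvPolynomial.aeval x (es f) := by
    have : T = ((MvPolynomial.aeval x).comp es).toRingHom := by
      apply MvPolynomial.ringHom_ext
      · intro a
        simp [T, es, hk]
      · intro i
        simp [T, es, ← hte, ht]
    exact fun f => RingHom.congr_fun this f
  have hTt : ∀ f, T f = MvPolynomial.aeval (fun i => algebraMap F C (t i)) f := by
    have : T = (MvPolynomial.aeval (R := k) (fun i => algebraMap F C (t i))).toRingHom := by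
      apply MvPolynomial.ringHom_ext
      · intro a
        simp [T, hk]
      · intro i
        simp [T, ht]
    exact fun f => RingHom.congr_fun this f
  have htind : AlgebraicIndependent k (fun i => algebraMap F C (t i)) := by
    intro f g hfg
    apply hTinj
    rw [hTt, hTt]; exact hfg
  have hxind : AlgebraicIndependent k x := by
    apply aux_indep
    simpa only [← hte] using htind
  have hxinj : Function.Injective x := hxind.injective
  have hesinj : Function.Injective es := by
    intro f g hfg
    apply hTinj
    rw [hTe, hTe, hfg]
  have halg : ∀ c : C, ∃ f : (MvPolynomial (Fin n) k)[X], f ≠ 0 ∧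
      eval₂ (MvPolynomial.aeval x).toRingHom c f = 0 := by
    intro c
    let _ : Algebra (MvPolynomial (Fin n) k) C := T.toAlgebra
    have _ : IsScalarTower (MvPolynomial (Fin n) k) F C := IsScalarTower.of_algebraMap_eq' rfl
    obtain ⟨f, hf, hf'⟩ := (IsFractionRing.isAlgebraic_iff (MvPolynomial (Fin n) k) F C).2
      (Algebra.IsAlgebraic.isAlgebraic (R := F) c)
    refine ⟨f.map es.toRingHom, (Polynomial.map_ne_zero_iff hesinj).2 hf, ?_⟩
    rw [eval₂_map]
    rw [aeval_def] at hf'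
    rw [← hf']
    congr 1
    exact RingHom.ext fun a => (hTe a).symm
  -- elements of `FP` are rational functions in the roots
  have hrepr : ∀ y ∈ FP, ∃ f g : MvPolynomial (Fin n) k, g ≠ 0 ∧
      y = MvPolynomial.aeval x f / MvPolynomial.aeval x g := by
    let ι : FractionRing (MvPolynomial (Fin n) k) →+* C :=
      IsFractionRing.lift (g := (MvPolynomial.aeval x : _ →ₐ[k] C).toRingHom) hxind
    have hι : ∀ f, ι (algebraMap _ _ f) = MvPolynomial.aeval x f := fun f =>
      IsFractionRing.lift_algebraMap (g := (MvPolynomial.aeval x : _ →ₐ[k] C).toRingHom) hxind f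
    have hmem : ∀ f : MvPolynomial (Fin n) k, MvPolynomial.aeval x f ∈ ι.fieldRange := fun f => ⟨_, hι f⟩
    have hFPι : ∀ y ∈ FP, y ∈ ι.fieldRange := by
      intro y hy
      rw [hFP] at hy
      induction hy using IntermediateField.adjoin_induction with
      | mem y hy =>
        rw [mem_rootSet_of_ne hPm.ne_zero, aeval_def, ← eval_map, hx, eval_prod,
          Finset.prod_eq_zero_iff] at hy
        obtain ⟨l, _, hl⟩ := hy
        rw [eval_add, eval_X, eval_C] at hl
        rw [eq_neg_of_add_eq_zero_left hl]
        have := hmem (MvPolynomial.X l)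
        rw [MvPolynomial.aeval_X] at this
        exact neg_mem this
      | algebraMap a =>
        obtain ⟨u, v, hv, rfl⟩ := IsFractionRing.div_surjective (A := MvPolynomial (Fin n) k) a
        rw [map_div₀]
        have h1 := hTe u
        have h3 := hTe v
        simp only [T, RingHom.comp_apply] at h1 h3
        rw [h1, h3]
        exact div_mem (hmem _) (hmem _)
      | add a b _ _ ha hb => exact add_mem ha hb
      | inv a _ ha => exact inv_mem ha
      | mul a b _ _ ha hb => exact mul_mem ha hb
    intro y hy
    obtain ⟨a, rfl⟩ := hFPι y hy
    obtain ⟨u, v, hv, rfl⟩ := IsFractionRing.div_surjective (A := MvPolynomial (Fin n) k) a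
    exact ⟨u, v, nonZeroDivisors.ne_zero hv, by rw [map_div₀, hι, hι]⟩
  -- Galois
  have hxroot : ∀ l, - x l ∈ P.rootSet C := by
    intro l
    rw [mem_rootSet_of_ne hPm.ne_zero, aeval_def, ← eval_map, hx, eval_prod]
    exact Finset.prod_eq_zero (Finset.mem_univ l) (by simp)
  have hPsep : P.Separable := by
    rw [← separable_map (algebraMap F C), hx]
    have : (∏ l, (X + Polynomial.C (x l))) = ∏ l, (X - Polynomial.C (- x l)) := by simp
    rw [this, separable_prod_X_sub_C_iff]
    exact neg_injective.comp hxinj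
  have hsf : P.IsSplittingField F FP := by
    rw [hFP]
    exact IntermediateField.adjoin_rootSet_isSplittingField (IsAlgClosed.splits _)
  have hgal : IsGalois F FP := IsGalois.of_separable_splitting_field hPsep
  have hfd : FiniteDimensional F FP := IsSplittingField.finiteDimensional FP P
  have hfdN : FiniteDimensional F N := by
    choose hle S hS1 hS2 using hNi
    have hfin : Set.Finite (⋃ i, (S i : Set C)) := Set.finite_iUnion fun i => (S i).finite_toSet
    have : Finite (⋃ i, (S i : Set C) : Set C) := hfin
    have hfdA : FiniteDimensional F (IntermediateField.adjoin F (⋃ i, (S i : Set C))) :=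
      IntermediateField.finiteDimensional_adjoin fun y _ =>
        (Algebra.IsAlgebraic.isAlgebraic (R := F) y).isIntegral
    have hNle : N ≤ IntermediateField.adjoin F (⋃ i, (S i : Set C)) := by
      intro y hy
      have hy' : y ∈ N.toSubfield := hy
      rw [hN] at hy'
      change y ∈ (IntermediateField.adjoin F (⋃ i, (S i : Set C))).toSubfield
      refine Subfield.closure_le.2 ?_ hy'
      refine Set.iUnion_subset fun i => ?_
      rw [hS2 i]
      change Subfield.closure _ ≤ (IntermediateField.adjoin F (⋃ i, (S i : Set C))).toSubfield
      rw [Subfield.closure_le, Set.union_subset_iff]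
      constructor
      · rw [hE i]
        change Subfield.closure _ ≤ (IntermediateField.adjoin F (⋃ i, (S i : Set C))).toSubfield
        rw [Subfield.closure_le, Set.union_subset_iff]
        constructor
        · rintro _ ⟨a, rfl⟩
          rw [hk]
          exact IntermediateField.algebraMap_mem _ _
        · rintro _ rfl
          exact IntermediateField.algebraMap_mem _ _
      · intro z hz
        exact IntermediateField.subset_adjoin F _ (Set.mem_iUnion.2 ⟨i, hz⟩)
    exact FiniteDimensional.of_injective (IntermediateField.inclusion hNle).toLinearMap
      (IntermediateField.inclusion_injective hNle)
  apply IntermediateField.LinearDisjoint.of_inf_eq_bot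
  rw [eq_bot_iff]
  rintro y ⟨hyFP, hyN⟩
  obtain ⟨f, g, hg, rfl⟩ := hrepr y hyFP
  have hx0 : ∀ g, g ≠ 0 → MvPolynomial.aeval x g ≠ (0 : C) := fun g hg h =>
    hg (hxind (by rw [h, map_zero]))
  obtain ⟨U, V, hV, hUV⟩ := aux_sym n f g hg (by
    intro i j hij
    obtain ⟨Ω, _, φ, φ', h0, h1, h3⟩ := aux_key p h2 n x hxind halg x hxind i j hij
    have hNeq : N.toSubfield ≤ RingHom.eqLocusField φ φ' := by
      rw [hN, Subfield.closure_le]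
      refine Set.iUnion_subset fun m => ?_
      obtain ⟨hle, S, hS1, hS2⟩ := hNi m
      rw [hS2]
      change Subfield.closure _ ≤ RingHom.eqLocusField φ φ'
      have htm : Transcendental k (algebraMap F C (t m)) := htind.transcendental m
      rw [transcendental_iff_injective] at htm
      let θ : FractionRing k[X] →+* C :=
        IsFractionRing.lift (g := (aeval (R := k) (algebraMap F C (t m))).toRingHom) htm
      have hθ : ∀ u, θ (algebraMap _ _ u) = aeval (algebraMap F C (t m)) u := fun u =>
        IsFractionRing.lift_algebraMap (g := (aeval (R := k) (algebraMap F C (t m))).toRingHom) htm u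
      have hEθ : E m ≤ θ.fieldRange := by
        rw [hE, Subfield.closure_le, Set.union_subset_iff]
        constructor
        · rintro _ ⟨a, rfl⟩
          exact ⟨algebraMap _ _ (Polynomial.C a), by rw [hθ, aeval_C]⟩
        · rintro _ rfl
          exact ⟨algebraMap _ _ X, by rw [hθ, aeval_X]⟩
      have h5 := h3 m θ (by intro u; rw [hθ, hte])
      rw [Subfield.closure_le, Set.union_subset_iff]
      constructor
      · intro z hz
        obtain ⟨a, rfl⟩ := hEθ hz
        exact h5 _ (X - Polynomial.C a) (X_sub_C_ne_zero a) (by simp)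
      · intro z hz
        obtain ⟨q, hq, hqz⟩ := hS1 z hz
        have hlift : q.map (E m).subtype ∈ lifts θ := by
          rw [lifts_iff_coeff_lifts]
          intro r
          rw [coeff_map]
          exact hEθ (q.coeff r).2
        obtain ⟨u, hu⟩ := (mem_lifts _).1 hlift
        refine h5 z u ?_ ?_
        · rintro rfl
          rw [Polynomial.map_zero] at hu
          exact (Polynomial.map_ne_zero hq) hu.symm
        · rw [← eval_map, hu, eval_map, hqz]
    have h6 : φ (MvPolynomial.aeval x f / MvPolynomial.aeval x g) =
        φ' (MvPolynomial.aeval x f / MvPolynomial.aeval x g) := hNeq hyN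
    rw [map_div₀ φ', h1, h1, ← map_div₀ φ] at h6
    have h7 := φ.injective h6
    have hg' : MvPolynomial.rename (Equiv.swap i j) g ≠ 0 := by
      rw [Ne, MvPolynomial.rename_eq_zero_iff_of_injective _ (Equiv.swap i j).injective]; exact hg
    rw [div_eq_div_iff (hx0 _ hg) (hx0 _ hg'), ← map_mul, ← map_mul] at h7
    exact hxind h7)
  have h8 := congrArg (MvPolynomial.aeval x) hUV
  rw [map_mul, map_mul] at h8
  change _ * MvPolynomial.aeval x (es V) = _ * MvPolynomial.aeval x (es U) at h8
  have h9 : MvPolynomial.aeval x f / MvPolynomial.aeval x g = T U / T V := by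
    rw [hTe, hTe, div_eq_div_iff (hx0 _ hg) (hx0 _ hV), h8, mul_comm]
  rw [h9, IntermediateField.mem_bot]
  exact ⟨algebraMap _ F U / algebraMap _ F V, by rw [map_div₀]; rfl⟩

/-- Let `q` be an odd prime power, `F = F_q(t_1, …, t_n)`, `F_P` the splitting field
over `F` of the generic polynomial `P = x^n + t_1 x^{n-1} + ⋯ + t_n` (realized as
the intermediate field of `F̄/F` generated by the roots of `P`), and `N/F` a
decomposable extension, i.e. a compositum `N = N_1 ⋯ N_n` with each
`N_i / F_q(t_i)` finite.  Then `F_P` and `N` are linearly disjoint over `F`. -/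
theorem generic_splitting_field_linearly_disjoint_of_decomposable
    (p k n : ℕ) [Fact p.Prime] (hp : Odd p) (hk : 0 < k)
    (Ni : Fin n → Subfield (GenFFCl p k n))
    (hNi : ∀ i, IsFiniteSubextension (oneVarFFSubfield p k n i) (Ni i))
    (N : IntermediateField (GenFF p k n) (GenFFCl p k n))
    (hN : N.toSubfield = Subfield.closure (⋃ i, (Ni i : Set (GenFFCl p k n))))
    (FP : IntermediateField (GenFF p k n) (GenFFCl p k n))
    (hFP : FP = IntermediateField.adjoin (GenFF p k n)
      ((genericPoly p k n).rootSet (GenFFCl p k n))) :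
    FP.LinearDisjoint N := by
  have h2 : (2 : GaloisField p k) ≠ 0 := by
    have h := Ring.two_ne_zero (R := GaloisField p k) (by
      rw [ringChar.eq (GaloisField p k) p]
      rintro rfl
      exact absurd hp (by decide))
    exact h
  let alg : Algebra (GaloisField p k) (GenFFCl p k n) :=
    ((algebraMap (GenFF p k n) (GenFFCl p k n)).comp
    ((algebraMap (MvPolynomial (Fin n) (GaloisField p k)) (GenFF p k n)).comp
      (MvPolynomial.C : GaloisField p k →+* MvPolynomial (Fin n) (GaloisField p k)))).toAlgebra
  refine @aux_main (GaloisField p k) (GenFF p k n) (GenFFCl p k n) _ _ _ p _ _ h2 n _ _ _ _ _ alg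
    (fun a => rfl) (genFFT p k n) (fun i => rfl) (genericPoly p k n) rfl
    (oneVarFFSubfield p k n) Ni ?_ hNi N hN FP hFP
  intro i
  rfl
end
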